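/- arXiv:2002.12072 — 3 statements merged into one kernel-verified Lean document; each statement's English description precedes it below -/
import Mathlib

section
/- Let p be a prime with p ≡ 1 (mod 4). Then Σ_{k=0}^{p−1} ( C(2k,k)·C(4k,2k)/64^k ) · p/(4k + 1) ≡ (−1)^{(p−1)/4} · ((3 − 2^{p−1})/2) · C((p−1)/2, (p−1)/4) (mod p²). -/
/-- A rational number is a `p`-integer if its denominator (in lowest terms)
is not divisible by `p`. -/
def isPInt (p : ℕ) (x : ℚ) : Prop := ¬ p ∣ x.den

/-- For `p`-integers `u, v`, `u ≡ v (mod p^k)` means `(u - v)/p^k` is a `p`-integer. -/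
def pCong (p k : ℕ) (u v : ℚ) : Prop := isPInt p ((u - v) / (p : ℚ) ^ k)

open Finset

/-- The subring of `ℚ` of rational numbers that are integral at `p`. -/
noncomputable def pIntegers (p : ℕ) [Fact p.Prime] : Subring ℚ := (Rat.padicValuation p).integer

theorem mem_pIntegers_iff {p : ℕ} [Fact p.Prime] {x : ℚ} : x ∈ pIntegers p ↔ isPInt p x :=
  Rat.padicValuation_le_one_iff

theorem inv_natCast_mem_pIntegers {p : ℕ} [hp : Fact p.Prime] {m : ℕ} (hm : ¬ p ∣ m) :
    (m : ℚ)⁻¹ ∈ pIntegers p := by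
  rw [mem_pIntegers_iff, isPInt]
  have hm0 : 0 < m := Nat.pos_of_ne_zero fun h => hm (h ▸ dvd_zero p)
  rwa [Rat.inv_natCast_den_of_pos hm0]

/-- Termwise congruent products are congruent. -/
theorem prod_congr_mod {R : Subring ℚ} {p : ℚ} (hp : p ∈ R) {f g : ℕ → ℚ} (n : ℕ)
    (hg : ∀ i < n, g i ∈ R) (hfg : ∀ i < n, ∃ r ∈ R, f i = g i + p * r) :
    (∏ i ∈ range n, g i) ∈ R ∧ ∃ r ∈ R, ∏ i ∈ range n, f i = ∏ i ∈ range n, g i + p * r := by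
  induction n with
  | zero => exact ⟨by simp, 0, R.zero_mem, by simp⟩
  | succ n ih =>
    obtain ⟨hG, r, hr, h⟩ := ih (fun i hi => hg i (by omega)) (fun i hi => hfg i (by omega))
    obtain ⟨s, hs, h'⟩ := hfg n (by omega)
    have hgn := hg n (by omega)
    refine ⟨by rw [prod_range_succ]; exact R.mul_mem hG hgn,
      (∏ i ∈ range n, g i) * s + r * g n + p * r * s, ?_, ?_⟩
    · exact R.add_mem (R.add_mem (R.mul_mem hG hs) (R.mul_mem hr hgn))
        (R.mul_mem (R.mul_mem hp hr) hs)
    · rw [prod_range_succ, prod_range_succ, h, h']; ring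

/-- First-order expansion of a product of factors congruent to `1`. -/
theorem prod_one_add_mod_sq {R : Subring ℚ} {p : ℚ} (hp : p ∈ R) {c : ℕ → ℚ} (n : ℕ)
    (hc : ∀ i < n, c i ∈ R) :
    (∑ i ∈ range n, c i) ∈ R ∧
      ∃ r ∈ R, ∏ i ∈ range n, (1 + p * c i) = 1 + p * ∑ i ∈ range n, c i + p ^ 2 * r := by
  induction n with
  | zero => exact ⟨by simp, 0, R.zero_mem, by simp⟩
  | succ n ih =>
    obtain ⟨hG, r, hr, h⟩ := ih (fun i hi => hc i (by omega))
    have hcn := hc n (by omega)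
    refine ⟨by rw [sum_range_succ]; exact R.add_mem hG hcn,
      (∑ i ∈ range n, c i) * c n + r + p * r * c n, ?_, ?_⟩
    · exact R.add_mem (R.add_mem (R.mul_mem hG hcn) hr) (R.mul_mem (R.mul_mem hp hr) hcn)
    · rw [prod_range_succ, sum_range_succ, h]; ring

theorem sum_mod {R : Subring ℚ} {q : ℚ} {f g : ℕ → ℚ} (n : ℕ)
    (h : ∀ i < n, ∃ r ∈ R, f i = g i + q * r) :
    ∃ r ∈ R, ∑ i ∈ range n, f i = ∑ i ∈ range n, g i + q * r := by
  induction n with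
  | zero => exact ⟨0, R.zero_mem, by simp⟩
  | succ n ih =>
    obtain ⟨r, hr, h1⟩ := ih fun i hi => h i (by omega)
    obtain ⟨s, hs, h2⟩ := h n (by omega)
    exact ⟨r + s, R.add_mem hr hs, by rw [sum_range_succ, sum_range_succ, h1, h2]; ring⟩

/-- The hypergeometric term `(1/4)_k (3/4)_k / k!²`. -/
def quarterTerm (k : ℕ) : ℚ := ∏ j ∈ range k, ((j : ℚ) + 1 / 4) * (j + 3 / 4) / (j + 1) ^ 2

/-- The hypergeometric term `(-n)_k (n+1)_k / k!²`, a shifted Legendre coefficient. -/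
def legendreTerm (n k : ℕ) : ℚ := ∏ j ∈ range k, ((j : ℚ) - n) * (j + n + 1) / (j + 1) ^ 2

theorem centralBinom_mul_centralBinom_div (k : ℕ) :
    ((2 * k).choose k : ℚ) * ((4 * k).choose (2 * k) : ℚ) / 64 ^ k = quarterTerm k := by
  have hc : ∀ m : ℕ, (Nat.centralBinom (m + 1) : ℚ)
      = 2 * (2 * m + 1) / (m + 1) * Nat.centralBinom m := by
    intro m
    have h : ((m : ℚ) + 1) * Nat.centralBinom (m + 1) = 2 * (2 * m + 1) * Nat.centralBinom m := by
      exact_mod_cast Nat.succ_mul_centralBinom_succ m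
    field_simp
    linarith
  have key : (Nat.centralBinom k : ℚ) * Nat.centralBinom (2 * k) / 64 ^ k = quarterTerm k := by
    induction k with
    | zero => simp [quarterTerm]
    | succ k ih =>
      have h2 : 2 * (k + 1) = 2 * k + 1 + 1 := by ring
      rw [quarterTerm, prod_range_succ, ← quarterTerm, ← ih, h2, hc, hc, hc, pow_succ]
      push_cast
      field_simp
      ring
  rw [← key, Nat.centralBinom, Nat.centralBinom]
  congr 4
  ring_nf

theorem legendreTerm_succ_right (n k : ℕ) :
    legendreTerm n (k + 1) = legendreTerm n k * (((k : ℚ) - n) * (k + n + 1) / (k + 1) ^ 2) :=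
  prod_range_succ _ _

theorem legendreTerm_eq_zero {n k : ℕ} (h : n < k) : legendreTerm n k = 0 :=
  prod_eq_zero (mem_range.2 h) (by simp)

theorem legendreTerm_succ_left (n k : ℕ) :
    ((n : ℚ) + 1 - k) * legendreTerm (n + 1) k = (n + 1 + k) * legendreTerm n k := by
  induction k with
  | zero => simp [legendreTerm]
  | succ k ih =>
    rw [legendreTerm_succ_right, legendreTerm_succ_right]
    have hk : (k : ℚ) + 1 ≠ 0 := by positivity
    push_cast
    field_simp
    linear_combination (-((n : ℚ) - k) * (k + n + 2)) * ih

theorem sum_legendreTerm_add (n m : ℕ) :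
    ((n : ℚ) + 1) ^ 2 * ∑ k ∈ range m, (legendreTerm (n + 1) k + legendreTerm n k) =
      -(m : ℚ) ^ 2 * (legendreTerm (n + 1) m + legendreTerm n m) := by
  induction m with
  | zero => simp
  | succ m ih =>
    rw [sum_range_succ, mul_add, ih, legendreTerm_succ_right, legendreTerm_succ_right]
    have hm : (m : ℚ) + 1 ≠ 0 := by positivity
    have h := legendreTerm_succ_left n m
    push_cast
    field_simp
    linear_combination -h

/-- Partial fraction expansion of `(1-x)_n / (x)_{n+1}`. -/
theorem sum_legendreTerm_div {x : ℚ} (hx : 0 < x) (n : ℕ) {N : ℕ} (hN : n < N) :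
    ∑ k ∈ range N, legendreTerm n k / (x + k) =
      (∏ j ∈ range n, ((j : ℚ) + 1 - x)) / ∏ j ∈ range (n + 1), ((j : ℚ) + x) := by
  induction n with
  | zero =>
    rw [sum_eq_single_of_mem 0 (mem_range.2 hN)]
    · simp [legendreTerm]
    · intro k _ hk
      rw [legendreTerm_eq_zero (Nat.pos_of_ne_zero hk), zero_div]
  | succ n ih =>
    have hrec : ((n : ℚ) + 1 + x) * ∑ k ∈ range N, legendreTerm (n + 1) k / (x + k) =
        ((n : ℚ) + 1 - x) * ∑ k ∈ range N, legendreTerm n k / (x + k) := by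
      have hsum := sum_legendreTerm_add n N
      rw [legendreTerm_eq_zero hN, legendreTerm_eq_zero (by omega), add_zero, mul_zero,
        mul_eq_zero, or_iff_right (by positivity)] at hsum
      rw [← sub_eq_zero, mul_sum, mul_sum, ← sum_sub_distrib, ← hsum]
      refine sum_congr rfl fun k _ => ?_
      have hxk : x + k ≠ 0 := by positivity
      have h := legendreTerm_succ_left n k
      field_simp
      linear_combination h
    have hnx : (n : ℚ) + 1 + x ≠ 0 := by positivity
    have hprod : ∏ j ∈ range (n + 1), ((j : ℚ) + x) ≠ 0 :=
      prod_ne_zero_iff.2 fun j _ => by positivity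
    rw [ih (by omega)] at hrec
    rw [prod_range_succ, prod_range_succ _ (n + 1)]
    push_cast
    rw [eq_div_iff (mul_ne_zero hprod hnx)]
    field_simp at hrec
    linear_combination hrec

theorem prod_natCast_sub (n : ℕ) :
    ∏ j ∈ range n, ((j : ℚ) - n) = (-1) ^ n * ∏ j ∈ range n, ((j : ℚ) + 1) := by
  rw [← prod_range_reflect, ← card_range n, ← prod_const, card_range, ← prod_mul_distrib]
  refine prod_congr rfl fun j hj => ?_
  rw [Nat.sub_sub, Nat.cast_sub (by have := mem_range.1 hj; omega)]
  push_cast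
  ring

theorem prod_add_one_add (n : ℕ) :
    ∏ j ∈ range n, ((n : ℚ) + 1 + j) = (2 * n).choose n * ∏ j ∈ range n, ((j : ℚ) + 1) := by
  have h := Nat.ascFactorial_eq_factorial_mul_choose n n
  rw [Nat.ascFactorial_eq_prod_range, ← prod_range_add_one_eq_factorial, ← two_mul] at h
  rw [mul_comm]
  exact_mod_cast h

theorem prod_natCast_add_one_ne_zero (n : ℕ) : ∏ j ∈ range n, ((j : ℚ) + 1) ≠ 0 :=
  prod_ne_zero_iff.2 fun j _ => by positivity

theorem legendreTerm_self (n : ℕ) : legendreTerm n n = (-1) ^ n * (2 * n).choose n := by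
  have h0 := prod_natCast_add_one_ne_zero n
  rw [legendreTerm, prod_div_distrib, prod_mul_distrib, prod_natCast_sub, prod_pow,
    prod_congr rfl fun (j : ℕ) _ => (by ring : (j : ℚ) + n + 1 = n + 1 + j), prod_add_one_add]
  field_simp

theorem prod_add_quarter (n : ℕ) :
    ∏ j ∈ range n, ((j : ℚ) + 1 / 4) = (-1) ^ n * (∏ j ∈ range n, ((j : ℚ) + 1)) *
      ∏ j ∈ range n, (1 + (4 * n + 1 : ℚ) * -(1 / (4 * (j + 1)))) := by
  rw [← prod_natCast_sub, ← prod_range_reflect, ← prod_range_reflect (fun j => (j : ℚ) - n),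
    ← prod_mul_distrib]
  refine prod_congr rfl fun j hj => ?_
  rw [Nat.sub_sub, Nat.cast_sub (by have := mem_range.1 hj; omega)]
  push_cast
  field_simp
  ring

theorem prod_add_three_quarters (n : ℕ) :
    ∏ j ∈ range n, ((j : ℚ) + 3 / 4) = (2 * n).choose n * (∏ j ∈ range n, ((j : ℚ) + 1)) *
      ∏ j ∈ range n, (1 + (4 * n + 1 : ℚ) * -(1 / (4 * (n + 1 + j)))) := by
  rw [← prod_add_one_add, ← prod_mul_distrib]
  refine prod_congr rfl fun j _ => ?_
  have h : (n : ℚ) + 1 + j ≠ 0 := by positivity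
  field_simp
  ring

theorem choose_pred_mod {p : ℕ} (hp : p.Prime) {k : ℕ} (hk : k < p) :
    (p : ℤ) ∣ (p - 1).choose k - (-1) ^ k := by
  induction k with
  | zero => simp
  | succ k ih =>
    have h1 : (p : ℤ) ∣ p.choose (k + 1) := by
      exact_mod_cast hp.dvd_choose_self (by omega) hk
    have h2 : (p.choose (k + 1) : ℤ) = (p - 1).choose k + (p - 1).choose (k + 1) := by
      have := Nat.choose_succ_succ (p - 1) k
      rw [Nat.succ_eq_add_one, Nat.succ_eq_add_one, Nat.sub_add_cancel hp.one_le] at this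
      exact_mod_cast this
    have h3 := dvd_sub h1 (ih (by omega))
    have e : ((p - 1).choose (k + 1) : ℤ) - (-1) ^ (k + 1) =
        p.choose (k + 1) - ((p - 1).choose k - (-1) ^ k) := by
      rw [h2, pow_succ]
      ring
    rwa [e]

theorem sum_alternating_harmonic (n : ℕ) :
    ∑ k ∈ range (2 * n), (-1 : ℚ) ^ k / (k + 1) = ∑ j ∈ range n, 1 / ((n : ℚ) + 1 + j) := by
  induction n with
  | zero => simp
  | succ n ih =>
    have h : ∑ j ∈ range n, 1 / ((n : ℚ) + 1 + j) + 1 / (2 * n + 1) =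
        1 / (n + 1) + ∑ j ∈ range n, 1 / (((n + 1 : ℕ) : ℚ) + 1 + j) := by
      have := (sum_range_succ (fun j : ℕ => 1 / ((n : ℚ) + 1 + j)) n).symm.trans
        (sum_range_succ' (fun j : ℕ => 1 / ((n : ℚ) + 1 + j)) n)
      rw [show (2 * n + 1 : ℚ) = n + 1 + n by ring, this, add_comm]
      congr 1
      · simp
      · refine sum_congr rfl fun j _ => ?_
        push_cast
        ring
    rw [show 2 * (n + 1) = 2 * n + 1 + 1 by ring, sum_range_succ, sum_range_succ, ih,
      sum_range_succ]
    have e : ∑ j ∈ range n, 1 / (((n + 1 : ℕ) : ℚ) + 1 + j) =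
        ∑ j ∈ range n, 1 / ((n : ℚ) + 1 + j) + 1 / (2 * n + 1) - 1 / (n + 1) := by
      linear_combination -h
    rw [e, pow_succ, pow_mul]
    push_cast
    have h1 : (2 * n + 1 : ℚ) ≠ 0 := by positivity
    have h2 : (n + 1 : ℚ) ≠ 0 := by positivity
    have h3 : (n + 1 + 1 + n : ℚ) ≠ 0 := by positivity
    have h4 : (2 * n + 1 + 1 : ℚ) ≠ 0 := by positivity
    field_simp
    ring

/-- The Fermat quotient of `2` as a half-length harmonic sum. -/
theorem two_pow_mod_sq {n p : ℕ} [hp : Fact p.Prime] (hpn : p = 4 * n + 1) :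
    ∃ r ∈ pIntegers p,
      (2 : ℚ) ^ (p - 1) = 1 + p * ∑ j ∈ range n, 1 / ((n : ℚ) + 1 + j) + p ^ 2 * r := by
  have hhalf : (2 : ℚ) ^ (p - 1) = 1 + ∑ k ∈ range (2 * n), (p.choose (k + 1) : ℚ) := by
    have h := Nat.sum_range_choose_halfway (2 * n)
    rw [sum_range_succ', Nat.choose_zero_right, show 2 * (2 * n) + 1 = p by omega] at h
    rw [show p - 1 = 2 * (2 * n) by omega, pow_mul, add_comm]
    norm_num
    exact_mod_cast h.symm
  obtain ⟨r, hr, h⟩ := sum_mod (R := pIntegers p) (q := (p : ℚ) ^ 2)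
    (f := fun k => (p.choose (k + 1) : ℚ)) (g := fun k => p * ((-1) ^ k / (k + 1))) (2 * n) <| by
    intro k hk
    obtain ⟨c, hc⟩ := choose_pred_mod hp.out (k := k) (by omega)
    have hc' : ((p - 1).choose k : ℚ) = (-1) ^ k + p * c := by
      have : ((p - 1).choose k : ℤ) = (-1) ^ k + p * c := by linarith
      exact_mod_cast this
    refine ⟨c * ((k + 1 : ℕ) : ℚ)⁻¹, (pIntegers p).mul_mem (intCast_mem _ c)
      (inv_natCast_mem_pIntegers (Nat.not_dvd_of_pos_of_lt (by omega) (by omega))), ?_⟩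
    have hs : (p : ℚ) * (p - 1).choose k = p.choose (k + 1) * (k + 1) := by
      have := Nat.add_one_mul_choose_eq (p - 1) k
      rw [Nat.sub_add_cancel hp.out.one_le] at this
      exact_mod_cast this
    rw [hc'] at hs
    have hk1 : (k : ℚ) + 1 ≠ 0 := by positivity
    push_cast
    field_simp
    linear_combination -hs
  exact ⟨r, hr, by rw [hhalf, h, ← mul_sum, sum_alternating_harmonic]; ring⟩

theorem inv_four_mem_pIntegers {n p : ℕ} [hp : Fact p.Prime] (hpn : p = 4 * n + 1) :
    (4 : ℚ)⁻¹ ∈ pIntegers p := by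
  have hn : n ≠ 0 := by rintro rfl; exact hp.out.one_lt.ne' (by simpa using hpn)
  exact_mod_cast inv_natCast_mem_pIntegers (p := p) (m := 4)
    (Nat.not_dvd_of_pos_of_lt (by omega) (by omega))

theorem quarterTerm_mod {n p : ℕ} [hp : Fact p.Prime] (hpn : p = 4 * n + 1) {k : ℕ} (hk : k < p) :
    ∃ r ∈ pIntegers p, quarterTerm k = legendreTerm n k + p * r := by
  have hpR : (p : ℚ) ∈ pIntegers p := natCast_mem _ p
  have hpQ : (p : ℚ) = 4 * n + 1 := by exact_mod_cast hpn
  have h4 := inv_four_mem_pIntegers hpn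
  have hinv : ∀ i < k, ((i + 1 : ℕ) : ℚ)⁻¹ ∈ pIntegers p := fun i hi =>
    inv_natCast_mem_pIntegers (Nat.not_dvd_of_pos_of_lt (by omega) (by omega))
  refine (prod_congr_mod hpR k (fun i hi => ?_) fun i hi => ?_).2
  · have : ((i : ℚ) - n) * (i + n + 1) / (i + 1) ^ 2 =
        ((((i : ℤ) - n) * (i + n + 1) : ℤ) : ℚ) * ((i + 1 : ℕ) : ℚ)⁻¹ ^ 2 := by
      push_cast
      field_simp
    rw [this]
    exact mul_mem (intCast_mem _ _) (pow_mem (hinv i hi) 2)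
  · refine ⟨((p + 2 : ℕ) : ℚ) * 4⁻¹ ^ 2 * ((i + 1 : ℕ) : ℚ)⁻¹ ^ 2,
      mul_mem (mul_mem (natCast_mem _ _) (pow_mem h4 2)) (pow_mem (hinv i hi) 2), ?_⟩
    push_cast
    rw [hpQ]
    field_simp
    ring

theorem prod_lower_mod {n p : ℕ} [hp : Fact p.Prime] (hpn : p = 4 * n + 1) :
    (∏ j ∈ range n, (1 + (p : ℚ) * -(1 / (4 * (j + 1)))))⁻¹ ∈ pIntegers p ∧
      ∃ r ∈ pIntegers p, ∏ j ∈ range n, (1 + (p : ℚ) * -(1 / (4 * (j + 1)))) = 1 + p * r := by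
  have h4 := inv_four_mem_pIntegers hpn
  constructor
  · rw [← prod_inv_distrib]
    refine prod_mem fun j hj => ?_
    have hj := mem_range.1 hj
    have hm : ((p - 4 * (j + 1) : ℕ) : ℚ) = p - 4 * (j + 1) := by
      rw [Nat.cast_sub (by omega)]
      push_cast
      ring
    have e : (1 + (p : ℚ) * -(1 / (4 * (j + 1))))⁻¹ =
        -((4 * (j + 1) : ℕ) : ℚ) * ((p - 4 * (j + 1) : ℕ) : ℚ)⁻¹ := by
      have h0 : ((p - 4 * (j + 1) : ℕ) : ℚ) ≠ 0 := Nat.cast_ne_zero.2 (by omega)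
      have e' : 1 + (p : ℚ) * -(1 / (4 * (j + 1))) =
          -((p - 4 * (j + 1) : ℕ) : ℚ) / (4 * (j + 1) : ℕ) := by
        rw [hm]
        push_cast
        field_simp
        ring
      rw [e', inv_div]
      field_simp
    rw [e]
    exact mul_mem (neg_mem (natCast_mem _ _))
      (inv_natCast_mem_pIntegers (Nat.not_dvd_of_pos_of_lt (by omega) (by omega)))
  · have h := (prod_congr_mod (R := pIntegers p) (p := p) (natCast_mem _ p)
      (f := fun j => 1 + (p : ℚ) * -(1 / (4 * (j + 1)))) (g := fun _ => 1) n
      (fun _ _ => one_mem _) fun j hj => ⟨_, ?_, rfl⟩).2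
    · simpa using h
    · have e : -(1 / (4 * ((j : ℚ) + 1))) = -(4⁻¹ * ((j + 1 : ℕ) : ℚ)⁻¹) := by
        push_cast
        field_simp
      rw [e]
      exact neg_mem (mul_mem h4
        (inv_natCast_mem_pIntegers (Nat.not_dvd_of_pos_of_lt (by omega) (by omega))))

theorem prod_upper_mod_sq {n p : ℕ} [hp : Fact p.Prime] (hpn : p = 4 * n + 1) :
    ∏ j ∈ range n, (1 + (p : ℚ) * -(1 / (4 * (n + 1 + j)))) ∈ pIntegers p ∧
      ∃ r ∈ pIntegers p, ∏ j ∈ range n, (1 + (p : ℚ) * -(1 / (4 * (n + 1 + j)))) =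
        1 - p / 4 * ∑ j ∈ range n, 1 / ((n : ℚ) + 1 + j) + p ^ 2 * r := by
  have h4 := inv_four_mem_pIntegers hpn
  have hc : ∀ j < n, -(1 / (4 * ((n : ℚ) + 1 + j))) ∈ pIntegers p := by
    intro j hj
    have e : -(1 / (4 * ((n : ℚ) + 1 + j))) = -(4⁻¹ * ((n + 1 + j : ℕ) : ℚ)⁻¹) := by
      push_cast
      have : (n : ℚ) + 1 + j ≠ 0 := by positivity
      field_simp
    rw [e]
    exact neg_mem (mul_mem h4
      (inv_natCast_mem_pIntegers (Nat.not_dvd_of_pos_of_lt (by omega) (by omega))))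
  refine ⟨prod_mem fun j hj =>
    add_mem (one_mem _) (mul_mem (natCast_mem _ p) (hc j (mem_range.1 hj))), ?_⟩
  obtain ⟨-, r, hr, h⟩ := prod_one_add_mod_sq (R := pIntegers p) (natCast_mem _ p) n hc
  refine ⟨r, hr, h.trans ?_⟩
  have e : ∑ j ∈ range n, -(1 / (4 * ((n : ℚ) + 1 + j))) =
      -(1 / 4) * ∑ j ∈ range n, 1 / ((n : ℚ) + 1 + j) := by
    rw [mul_sum]
    refine sum_congr rfl fun j _ => ?_
    have : (n : ℚ) + 1 + j ≠ 0 := by positivity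
    field_simp
  rw [e]
  ring

/-- Replacing `quarterTerm` by `legendreTerm` modulo `p²`, away from the term `4k + 1 = p`. -/
theorem sum_quarterTerm_mod_sq {n p : ℕ} [hp : Fact p.Prime] (hpn : p = 4 * n + 1) :
    ∃ r ∈ pIntegers p, ∑ k ∈ range p, quarterTerm k * ((p : ℚ) / (4 * k + 1)) =
      ∑ k ∈ range p, legendreTerm n k * ((p : ℚ) / (4 * k + 1)) +
        (quarterTerm n - legendreTerm n n) + p ^ 2 * r := by
  have hpQ : (p : ℚ) = 4 * n + 1 := by exact_mod_cast hpn
  obtain ⟨r, hr, h⟩ := sum_mod (R := pIntegers p) (q := (p : ℚ) ^ 2)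
    (f := fun k => quarterTerm k * ((p : ℚ) / (4 * k + 1)))
    (g := fun k => legendreTerm n k * ((p : ℚ) / (4 * k + 1)) +
      if k = n then quarterTerm n - legendreTerm n n else 0) p <| by
    intro k hk
    by_cases hkn : k = n
    · subst hkn
      have h0 : (4 * k + 1 : ℚ) ≠ 0 := by positivity
      exact ⟨0, zero_mem _, by simp only [hpQ, if_true]; rw [div_self h0]; ring⟩
    · obtain ⟨s, hs, h⟩ := quarterTerm_mod hpn hk
      refine ⟨s * ((4 * k + 1 : ℕ) : ℚ)⁻¹, mul_mem hs (inv_natCast_mem_pIntegers ?_), ?_⟩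
      · rintro ⟨m, hm⟩
        have hm4 : m < 4 := by
          by_contra! hcon
          have := Nat.mul_le_mul_left p hcon
          omega
        interval_cases m <;> omega
      · simp only [hkn, if_false, h]
        push_cast
        field_simp
        ring
  refine ⟨r, hr, h.trans ?_⟩
  rw [sum_add_distrib, sum_ite_eq' (range p) n, if_pos (mem_range.2 (by omega))]

theorem stmt9 (p : ℕ) (hp : p.Prime) (hp4 : p % 4 = 1) :
    pCong p 2
      (∑ k ∈ Finset.range p,
        ((2 * k).choose k : ℚ) * ((4 * k).choose (2 * k) : ℚ) / 64 ^ k *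
          ((p : ℚ) / (4 * (k : ℚ) + 1)))
      ((-1 : ℚ) ^ ((p - 1) / 4) * ((3 - (2 : ℚ) ^ (p - 1)) / 2) *
        (((p - 1) / 2).choose ((p - 1) / 4) : ℚ)) := by
  have : Fact p.Prime := ⟨hp⟩
  obtain ⟨n, hpn⟩ : ∃ n, p = 4 * n + 1 := ⟨p / 4, by omega⟩
  have hpQ : (p : ℚ) = 4 * n + 1 := by exact_mod_cast hpn
  have hp0 : (p : ℚ) ≠ 0 := Nat.cast_ne_zero.2 hp.ne_zero
  rw [show (p - 1) / 4 = n by omega, show (p - 1) / 2 = 2 * n by omega]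
  simp only [centralBinom_mul_centralBinom_div]
  obtain ⟨r, hr, hS⟩ := sum_quarterTerm_mod_sq hpn
  obtain ⟨s, hs, h2⟩ := two_pow_mod_sq hpn
  obtain ⟨hA, u, hu, hAu⟩ := prod_lower_mod hpn
  obtain ⟨hB, t, ht, hBt⟩ := prod_upper_mod_sq hpn
  have hq := prod_add_quarter n
  have htq := prod_add_three_quarters n
  rw [← hpQ] at hq htq
  have hP := prod_natCast_add_one_ne_zero n
  have hq0 : ∏ j ∈ range n, ((j : ℚ) + 1 / 4) ≠ 0 :=
    prod_ne_zero_iff.2 fun j _ => by positivity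
  set A := ∏ j ∈ range n, (1 + (p : ℚ) * -(1 / (4 * (j + 1))))
  set B := ∏ j ∈ range n, (1 + (p : ℚ) * -(1 / (4 * (n + 1 + j))))
  set P := ∏ j ∈ range n, ((j : ℚ) + 1)
  set H := ∑ j ∈ range n, 1 / ((n : ℚ) + 1 + j)
  set C : ℚ := ((2 * n).choose n : ℚ)
  have hA0 : A ≠ 0 := by
    intro h
    rw [hq, h, mul_zero] at hq0
    exact hq0 rfl
  have hsign : ((-1 : ℚ) ^ n) ^ 2 = 1 := by rw [← pow_mul, mul_comm, pow_mul]; simp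
  have hL : ∑ k ∈ range p, legendreTerm n k * ((p : ℚ) / (4 * k + 1)) =
      (-1) ^ n * C * (B * A⁻¹) := by
    have h := sum_legendreTerm_div (x := 1 / 4) (by norm_num) n (N := p) (by omega)
    rw [prod_range_succ, prod_congr rfl fun (j : ℕ) _ => (by ring : (j : ℚ) + 1 - 1 / 4 = j + 3 / 4),
      htq, hq, show (n : ℚ) + 1 / 4 = p / 4 by rw [hpQ]; ring] at h
    have e : ∀ k ∈ range p, legendreTerm n k * ((p : ℚ) / (4 * k + 1)) =
        p / 4 * (legendreTerm n k / (1 / 4 + k)) := by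
      intro k _
      have h1 : (4 * k + 1 : ℚ) ≠ 0 := by positivity
      have h2 : (1 / 4 + k : ℚ) ≠ 0 := by positivity
      field_simp
      ring
    rw [sum_congr rfl e, ← mul_sum, h]
    have hs0 : (-1 : ℚ) ^ n ≠ 0 := by positivity
    field_simp
    rw [hsign, mul_one]
  have hQ : quarterTerm n = (-1) ^ n * C * (A * B) := by
    rw [quarterTerm, prod_div_distrib, prod_mul_distrib, prod_pow, hq, htq]
    change _ / P ^ 2 = _
    field_simp
  rw [hL, hQ, legendreTerm_self] at hS
  rw [pCong, ← mem_pIntegers_iff]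
  have h2inv : (2 : ℚ)⁻¹ ∈ pIntegers p := by
    have := mul_mem (natCast_mem (pIntegers p) 2) (inv_four_mem_pIntegers hpn)
    norm_num at this ⊢
    exact this
  have hmain : B * A⁻¹ + A * B - 1 = 1 - p / 2 * H + p ^ 2 * (2 * t + u ^ 2 * B * A⁻¹) := by
    have e : B * A⁻¹ + A * B = 2 * B + (A - 1) ^ 2 * B * A⁻¹ := by
      field_simp
      ring
    rw [e, show A - 1 = p * u by rw [hAu]; ring]
    linear_combination 2 * hBt
  have key : (∑ k ∈ range p, quarterTerm k * ((p : ℚ) / (4 * k + 1)) -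
      (-1) ^ n * ((3 - (2 : ℚ) ^ (p - 1)) / 2) * C) / p ^ 2 =
      (-1) ^ n * C * (2 * t + u ^ 2 * B * A⁻¹ + s * 2⁻¹) + r := by
    rw [div_eq_iff (pow_ne_zero 2 hp0), hS, h2]
    linear_combination (-1) ^ n * C * hmain
  rw [key]
  exact add_mem (mul_mem (mul_mem (pow_mem (neg_mem (one_mem _)) n) (natCast_mem _ _))
    (add_mem (add_mem (mul_mem (ofNat_mem _ 2) ht)
      (mul_mem (mul_mem (pow_mem hu 2) hB) hA)) (mul_mem hs h2inv))) hr
end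

section
/- Let p be an odd prime and let b be a p-integer with ⟨b⟩_p > p/2. Set s = (b − ⟨b⟩_p)/p and assume s ≢ −1 (mod p). Then Σ_{k=0}^{p−1} ( C(2k,k)²/16^k ) · p/(k + b) ≡ Σ_{k=0}^{(p−1)/2} ( C(2k,k)²/16^k ) · p/(k + b) ≡ ( C(2(⟨b⟩_p − (p+1)/2), ⟨b⟩_p − (p+1)/2)² / ( (s + 1)·16^{⟨b⟩_p − (p+1)/2} ) ) · ( 1 + p(2s + 1)·( H_{p − ⟨b⟩_p} − H_{⟨b⟩_p − (p+1)/2} ) ) ≡ (1/(s+1))·C((p−1)/2, p − ⟨b⟩_p)² · ( 1 + p·( 2·q_p(2) + (2s + 2)·H_{p − ⟨b⟩_p} − (2s + 1)·H_{⟨b⟩_p − (p+1)/2} ) ) (mod p²), where q_p(2) = (2^{p−1} − 1)/p. -/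
section

variable {p : ℕ}

theorem isPInt_iff {x : ℚ} :
    isPInt p x ↔ ∃ a d : ℤ, ¬ (p : ℤ) ∣ d ∧ x = a / d := by
  constructor
  · intro h
    refine ⟨x.num, x.den, fun h' => h (by exact_mod_cast h'), ?_⟩
    simpa using (Rat.num_div_den x).symm
  · rintro ⟨a, d, hd, rfl⟩ h
    have := Rat.den_dvd a d
    exact hd ((Int.natCast_dvd_natCast.2 h).trans (by simpa [Rat.divInt_eq_div] using this))

theorem isPInt_int (hp : p.Prime) (a : ℤ) : isPInt p a :=
  isPInt_iff.2 ⟨a, 1, fun h => hp.one_lt.ne' (by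
    have := Int.eq_one_of_dvd_one (by positivity) h; exact_mod_cast this), by simp⟩

theorem isPInt_nat (hp : p.Prime) (a : ℕ) : isPInt p a := by
  simpa using isPInt_int hp a

theorem isPInt_one (hp : p.Prime) : isPInt p 1 := by simpa using isPInt_nat hp 1

theorem isPInt_two (hp : p.Prime) : isPInt p 2 := by simpa using isPInt_nat hp 2

theorem isPInt.add (hp : p.Prime) {x y : ℚ} (hx : isPInt p x) (hy : isPInt p y) :
    isPInt p (x + y) := by
  obtain ⟨a, d, hd, rfl⟩ := isPInt_iff.1 hx
  obtain ⟨a', d', hd', rfl⟩ := isPInt_iff.1 hy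
  have h0 : (d : ℚ) ≠ 0 := by rintro h; simp_all
  have h0' : (d' : ℚ) ≠ 0 := by rintro h; simp_all
  refine isPInt_iff.2 ⟨a * d' + a' * d, d * d',
    fun h => ((Nat.prime_iff_prime_int.1 hp).dvd_or_dvd h).elim hd hd', ?_⟩
  push_cast
  field_simp

theorem isPInt.mul (hp : p.Prime) {x y : ℚ} (hx : isPInt p x) (hy : isPInt p y) :
    isPInt p (x * y) := by
  obtain ⟨a, d, hd, rfl⟩ := isPInt_iff.1 hx
  obtain ⟨a', d', hd', rfl⟩ := isPInt_iff.1 hy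
  refine isPInt_iff.2 ⟨a * a', d * d',
    fun h => ((Nat.prime_iff_prime_int.1 hp).dvd_or_dvd h).elim hd hd', ?_⟩
  push_cast
  exact div_mul_div_comm ..

theorem isPInt.pow (hp : p.Prime) {x : ℚ} (hx : isPInt p x) (k : ℕ) : isPInt p (x ^ k) := by
  induction k with
  | zero => simpa using isPInt_one hp
  | succ k ih => rw [pow_succ]; exact ih.mul hp hx

theorem isPInt.neg (hp : p.Prime) {x : ℚ} (hx : isPInt p x) : isPInt p (-x) := by
  simpa using (isPInt_int hp (-1)).mul hp hx

theorem isPInt.sub (hp : p.Prime) {x y : ℚ} (hx : isPInt p x) (hy : isPInt p y) :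
    isPInt p (x - y) := by
  rw [sub_eq_add_neg]; exact hx.add hp (hy.neg hp)

theorem isPInt.sum (hp : p.Prime) {ι : Type*} (s : Finset ι) {f : ι → ℚ}
    (h : ∀ i ∈ s, isPInt p (f i)) : isPInt p (∑ i ∈ s, f i) :=
  Finset.sum_induction f (isPInt p) (fun _ _ hx hy => hx.add hp hy)
    (by simpa using isPInt_nat hp 0) h

theorem isPInt_inv_nat {a : ℕ} (ha : ¬ p ∣ a) : isPInt p (a : ℚ)⁻¹ :=
  isPInt_iff.2 ⟨1, a, by exact_mod_cast ha, by simp⟩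

theorem isPInt_inv_succ {k : ℕ} (hk : k + 1 < p) :
    isPInt p ((k : ℚ) + 1)⁻¹ := by
  simpa using isPInt_inv_nat (Nat.not_dvd_of_pos_of_lt k.succ_pos hk)

theorem isPInt.inv_of_not_isPInt_div (hp : p.Prime) {x : ℚ} (hx : isPInt p x)
    (h : ¬ isPInt p (x / p)) : isPInt p x⁻¹ := by
  obtain ⟨a, d, hd, rfl⟩ := isPInt_iff.1 hx
  by_cases ha : (p : ℤ) ∣ a
  · obtain ⟨c, rfl⟩ := ha
    refine absurd (isPInt_iff.2 ⟨c, d, hd, ?_⟩) h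
    have : (p : ℚ) ≠ 0 := by exact_mod_cast hp.ne_zero
    push_cast
    rw [mul_div_assoc, mul_div_cancel_left₀ _ this]
  · exact isPInt_iff.2 ⟨d, a, ha, by simp⟩

theorem isPInt.one_add_mul_ne_zero {y : ℚ} (hy : isPInt p y) :
    1 + (p : ℚ) * y ≠ 0 := by
  intro h
  obtain ⟨a, d, hd, rfl⟩ := isPInt_iff.1 hy
  have h0 : (d : ℚ) ≠ 0 := by rintro h; simp_all
  field_simp at h
  rw [mul_zero] at h
  have h' : d + p * a = 0 := by exact_mod_cast h
  exact hd ⟨-a, by linarith⟩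

theorem isPInt.inv_one_add_mul {y : ℚ} (hy : isPInt p y) :
    isPInt p (1 + (p : ℚ) * y)⁻¹ := by
  obtain ⟨a, d, hd, rfl⟩ := isPInt_iff.1 hy
  have h0 : (d : ℚ) ≠ 0 := by rintro h; simp_all
  refine isPInt_iff.2 ⟨d, d + p * a, fun h => hd ?_, ?_⟩
  · exact (dvd_add_left (dvd_mul_right _ _)).1 h
  · push_cast
    rw [← inv_div]
    field_simp

theorem isPInt.inv_nat_add_mul (hp : p.Prime) {a : ℕ} (ha : ¬ p ∣ a) {y : ℚ}
    (hy : isPInt p y) : isPInt p ((a : ℚ) + p * y)⁻¹ := by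
  have h0 : (a : ℚ) ≠ 0 := by rintro h; simp_all
  have : (a : ℚ) + p * y = a * (1 + p * (y * (a : ℚ)⁻¹)) := by field_simp
  rw [this, mul_inv]
  exact (isPInt_inv_nat ha).mul hp
    (isPInt.inv_one_add_mul (hy.mul hp (isPInt_inv_nat ha)))

theorem isPInt_harmonic (hp : p.Prime) {k : ℕ} (hk : k < p) : isPInt p (harmonic k) := by
  unfold harmonic
  refine isPInt.sum hp _ fun i hi => ?_
  have := Finset.mem_range.1 hi
  simpa using isPInt_inv_succ (k := i) (by omega)

theorem pCong_iff (hp : p.Prime) {k : ℕ} {x y : ℚ} :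
    pCong p k x y ↔ ∃ d, isPInt p d ∧ x = y + (p : ℚ) ^ k * d := by
  have : (p : ℚ) ^ k ≠ 0 := pow_ne_zero _ (by exact_mod_cast hp.ne_zero)
  constructor
  · intro h
    exact ⟨_, h, by field_simp; ring⟩
  · rintro ⟨d, hd, rfl⟩
    unfold pCong
    convert hd using 1
    field_simp
    ring

theorem pCong.refl (hp : p.Prime) (k : ℕ) (x : ℚ) : pCong p k x x :=
  (pCong_iff hp).2 ⟨0, by simpa using isPInt_nat hp 0, by simp⟩

theorem pCong.symm (hp : p.Prime) {k : ℕ} {x y : ℚ} (h : pCong p k x y) : pCong p k y x := by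
  obtain ⟨d, hd, rfl⟩ := (pCong_iff hp).1 h
  exact (pCong_iff hp).2 ⟨-d, hd.neg hp, by ring⟩

theorem pCong.trans (hp : p.Prime) {k : ℕ} {x y z : ℚ} (h : pCong p k x y)
    (h' : pCong p k y z) : pCong p k x z := by
  obtain ⟨d, hd, rfl⟩ := (pCong_iff hp).1 h
  obtain ⟨e, he, rfl⟩ := (pCong_iff hp).1 h'
  exact (pCong_iff hp).2 ⟨d + e, hd.add hp he, by ring⟩

theorem pCong.mul_left (hp : p.Prime) {k : ℕ} {x y c : ℚ} (hc : isPInt p c)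
    (h : pCong p k x y) : pCong p k (c * x) (c * y) := by
  obtain ⟨d, hd, rfl⟩ := (pCong_iff hp).1 h
  exact (pCong_iff hp).2 ⟨c * d, hc.mul hp hd, by ring⟩

theorem pCong.mul_right (hp : p.Prime) {k : ℕ} {x y c : ℚ} (hc : isPInt p c)
    (h : pCong p k x y) : pCong p k (x * c) (y * c) := by
  simpa [mul_comm] using h.mul_left hp hc

theorem pCong.add (hp : p.Prime) {k : ℕ} {x y x' y' : ℚ} (h : pCong p k x y)
    (h' : pCong p k x' y') : pCong p k (x + x') (y + y') := by
  obtain ⟨d, hd, rfl⟩ := (pCong_iff hp).1 h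
  obtain ⟨e, he, rfl⟩ := (pCong_iff hp).1 h'
  exact (pCong_iff hp).2 ⟨d + e, hd.add hp he, by ring⟩

theorem pCong.sum (hp : p.Prime) {k : ℕ} {ι : Type*} (s : Finset ι) {f g : ι → ℚ}
    (h : ∀ i ∈ s, pCong p k (f i) (g i)) : pCong p k (∑ i ∈ s, f i) (∑ i ∈ s, g i) := by
  unfold pCong
  rw [← Finset.sum_sub_distrib, Finset.sum_div]
  exact isPInt.sum hp _ h

/-- `x ≡ 1 + p h (mod p²)` with `h` a `p`-integer: `h` is a first-order logarithm of `x`. -/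
def NearOne (p : ℕ) (x h : ℚ) : Prop := isPInt p h ∧ pCong p 2 x (1 + p * h)

theorem nearOne_one_add (hp : p.Prime) {h : ℚ} (hh : isPInt p h) : NearOne p (1 + p * h) h :=
  ⟨hh, pCong.refl hp _ _⟩

theorem NearOne.exists_eq (hp : p.Prime) {x h : ℚ} (hx : NearOne p x h) :
    ∃ d, isPInt p d ∧ x = 1 + p * (h + p * d) := by
  obtain ⟨d, hd, rfl⟩ := (pCong_iff hp).1 hx.2
  exact ⟨d, hd, by ring⟩

theorem NearOne.ne_zero (hp : p.Prime) {x h : ℚ} (hx : NearOne p x h) : x ≠ 0 := by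
  obtain ⟨d, hd, rfl⟩ := hx.exists_eq hp
  exact (hx.1.add hp ((isPInt_nat hp p).mul hp hd)).one_add_mul_ne_zero

theorem NearOne.mul (hp : p.Prime) {x h y k : ℚ} (hx : NearOne p x h) (hy : NearOne p y k) :
    NearOne p (x * y) (h + k) := by
  obtain ⟨d, hd, rfl⟩ := hx.exists_eq hp
  obtain ⟨e, he, rfl⟩ := hy.exists_eq hp
  have hP := isPInt_nat hp p
  refine ⟨hx.1.add hp hy.1, (pCong_iff hp).2
    ⟨d + e + (h + p * d) * (k + p * e), (hd.add hp he).add hp ?_, by ring⟩⟩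
  exact (hx.1.add hp (hP.mul hp hd)).mul hp (hy.1.add hp (hP.mul hp he))

theorem NearOne.inv (hp : p.Prime) {x h : ℚ} (hx : NearOne p x h) : NearOne p x⁻¹ (-h) := by
  have h0 := hx.ne_zero hp
  obtain ⟨d, hd, rfl⟩ := hx.exists_eq hp
  have hy := hx.1.add hp ((isPInt_nat hp p).mul hp hd)
  refine ⟨hx.1.neg hp, (pCong_iff hp).2
    ⟨-d + (h + p * d) ^ 2 * (1 + p * (h + p * d))⁻¹,
      (hd.neg hp).add hp ((hy.pow hp 2).mul hp (hy.inv_one_add_mul)), ?_⟩⟩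
  field_simp
  ring

theorem NearOne.congr (hp : p.Prime) {x h k : ℚ} (hx : NearOne p x h) (hk : pCong p 1 h k) :
    NearOne p x k := by
  obtain ⟨e, he, rfl⟩ := (pCong_iff hp).1 (hk.symm hp)
  refine ⟨hx.1.add hp (((isPInt_nat hp p).pow hp 1).mul hp he), hx.2.trans hp ?_⟩
  exact (pCong_iff hp).2 ⟨-e, he.neg hp, by ring⟩

/-- The shifted factorial `(1 + p c)(2 + p c) ⋯ (k + p c)`. -/
def shiftedFactorial (p k : ℕ) (c : ℚ) : ℚ := ∏ j ∈ Finset.range k, ((j : ℚ) + 1 + p * c)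

theorem nearOne_shiftedFactorial (hp : p.Prime) {k : ℕ} (hk : k < p) {c : ℚ}
    (hc : isPInt p c) :
    NearOne p (shiftedFactorial p k c / k.factorial) (c * harmonic k) := by
  induction k with
  | zero =>
    have h := nearOne_one_add hp (isPInt_nat hp 0)
    simpa only [Nat.cast_zero, mul_zero, add_zero, shiftedFactorial, Finset.range_zero,
      Finset.prod_empty, Nat.factorial_zero, Nat.cast_one, div_one, harmonic_zero] using h
  | succ k ih =>
    have h := (ih (by omega)).mul hp
      (nearOne_one_add hp (hc.mul hp (isPInt_inv_succ hk)))
    have h0 : ((k : ℚ) + 1) ≠ 0 := by positivity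
    have h1 : (k.factorial : ℚ) ≠ 0 := by positivity
    convert h using 1
    · rw [shiftedFactorial, Finset.prod_range_succ, ← shiftedFactorial, Nat.factorial_succ]
      push_cast
      field_simp
    · rw [harmonic_succ]
      push_cast
      ring

/-- The coefficients `(-1)^k C(n,k) C(n+k,n)` of the shifted Legendre polynomial. -/
def legendreCoeff (n k : ℕ) : ℚ := (-1) ^ k * n.choose k * (n + k).choose n

theorem legendreCoeff_zero (n : ℕ) : legendreCoeff n 0 = 1 := by simp [legendreCoeff]

theorem legendreCoeff_eq_zero {n k : ℕ} (h : n < k) : legendreCoeff n k = 0 := by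
  simp [legendreCoeff, Nat.choose_eq_zero_of_lt h]

theorem legendreCoeff_mul_factorial {n m : ℕ} (h : m ≤ n) :
    legendreCoeff n m * (m.factorial ^ 2 * (n - m).factorial) = (-1) ^ m * (n + m).factorial := by
  have h1 : (n.choose m * m.factorial * (n - m).factorial : ℚ) = n.factorial := by
    exact_mod_cast Nat.choose_mul_factorial_mul_factorial h
  have h2 : ((n + m).choose n * n.factorial * m.factorial : ℚ) = (n + m).factorial := by
    rw [Nat.choose_symm_add]
    exact_mod_cast Nat.add_choose_mul_factorial_mul_factorial n m
  rw [legendreCoeff, ← h2, ← h1]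
  ring

theorem legendreCoeff_succ_right {n k : ℕ} (h : k ≤ n) :
    legendreCoeff n (k + 1) * ((k : ℚ) + 1) ^ 2 = -legendreCoeff n k * (n + k + 1) * (n - k) := by
  have h1 : (n.choose (k + 1) * (k + 1) : ℚ) = n.choose k * (n - k) := by
    rw [← Nat.cast_sub h]
    exact_mod_cast Nat.choose_succ_right_eq n k
  have h2 : ((n + k).choose n * (n + k + 1) : ℚ) = (n + k + 1).choose n * (k + 1) := by
    have := Nat.choose_mul_succ_eq (n + k) n
    rw [show n + k + 1 - n = k + 1 by omega] at this
    exact_mod_cast this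
  rw [legendreCoeff, legendreCoeff, ← add_assoc, pow_succ]
  linear_combination (-(-1) ^ k * ((n + k + 1).choose n * (k + 1) : ℚ)) * h1
    + ((-1) ^ k * (n.choose k * (n - k) : ℚ)) * h2

theorem legendreCoeff_succ_left {n k : ℕ} (h : k ≤ n + 1) :
    legendreCoeff (n + 1) k * ((n : ℚ) + 1 - k) = legendreCoeff n k * (n + 1 + k) := by
  have h1 : (n.choose k * (n + 1) : ℚ) = (n + 1).choose k * (n + 1 - k) := by
    have := Nat.choose_mul_succ_eq n k
    rw [← Nat.cast_add_one, ← Nat.cast_sub h]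
    exact_mod_cast this
  have h2 : ((n + k + 1) * (n + k).choose n : ℚ) = (n + 1 + k).choose (n + 1) * (n + 1) := by
    have := Nat.add_one_mul_choose_eq (n + k) n
    rw [show n + 1 + k = n + k + 1 by omega]
    exact_mod_cast this
  have h0 : (n : ℚ) + 1 ≠ 0 := by positivity
  refine mul_right_cancel₀ h0 ?_
  rw [legendreCoeff, legendreCoeff]
  linear_combination (-(-1) ^ k * ((n + 1 + k).choose (n + 1) * (n + 1) : ℚ)) * h1
    - ((-1) ^ k * (n.choose k * (n + 1) : ℚ)) * h2

theorem sum_legendreCoeff (n : ℕ) :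
    ∑ k ∈ Finset.range (n + 1), legendreCoeff n k = (-1) ^ n := by
  have h := Polynomial.shiftedLegendre_eval_symm n (1 : ℚ)
  rw [sub_self, Polynomial.shiftedLegendre] at h
  simpa [legendreCoeff, Finset.sum_range_succ'] using h

theorem sum_legendreCoeff_div_mul_prod (n : ℕ) (x : ℚ) (hx : ∀ k ≤ n, (k : ℚ) + x ≠ 0) :
    (∑ k ∈ Finset.range (n + 1), legendreCoeff n k / (k + x)) *
      ∏ j ∈ Finset.range (n + 1), (x + j) = ∏ j ∈ Finset.range n, ((j : ℚ) + 1 - x) := by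
  induction n with
  | zero =>
    have := hx 0 le_rfl
    simp only [Nat.cast_zero, zero_add] at this
    simp [legendreCoeff_zero, this]
  | succ n ih =>
    have key : (∑ k ∈ Finset.range (n + 2), legendreCoeff (n + 1) k / (k + x)) * (x + (n + 1)) =
        (∑ k ∈ Finset.range (n + 1), legendreCoeff n k / (k + x)) * (n + 1 - x) := by
      have hn : legendreCoeff n (n + 1) = 0 := legendreCoeff_eq_zero n.lt_succ_self
      have hterm : ∀ k ∈ Finset.range (n + 2),
          legendreCoeff (n + 1) k / (k + x) * (x + (n + 1)) =
            legendreCoeff (n + 1) k + legendreCoeff n k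
              + legendreCoeff n k / (k + x) * (n + 1 - x) := by
        intro k hk
        have hk' : k ≤ n + 1 := Nat.lt_succ_iff.1 (Finset.mem_range.1 hk)
        have h0 := hx k hk'
        have h1 := legendreCoeff_succ_left hk'
        field_simp
        linear_combination h1
      rw [Finset.sum_mul, Finset.sum_congr rfl hterm, Finset.sum_add_distrib,
        Finset.sum_add_distrib, sum_legendreCoeff, Finset.sum_range_succ (legendreCoeff n),
        sum_legendreCoeff, Finset.sum_range_succ _ (n + 1), hn, ← Finset.sum_mul]
      ring
    rw [Finset.prod_range_succ, Finset.prod_range_succ (fun j : ℕ => (j : ℚ) + 1 - x),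
      ← ih fun k hk => hx k (hk.trans n.le_succ)]
    push_cast
    linear_combination (∏ j ∈ Finset.range (n + 1), (x + j)) * key

theorem prod_add_eq_shiftedFactorial (p m n : ℕ) (s : ℚ) :
    shiftedFactorial p m s * ∏ j ∈ Finset.range n, ((m : ℚ) + j + 1 + p * s) =
      shiftedFactorial p (n + m) s := by
  rw [shiftedFactorial, shiftedFactorial, add_comm n m, Finset.prod_range_add]
  push_cast
  rfl

theorem sum_legendreCoeff_mul_shiftedFactorial {n m r : ℕ} (hr : r + m = n) {b s : ℚ}
    (hpn : p = 2 * n + 1) (hb : b = n + 1 + m + p * s) (hx : ∀ k ≤ n, (k : ℚ) + b ≠ 0) :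
    (∑ k ∈ Finset.range (n + 1), legendreCoeff n k * (p / (k + b))) * (s + 1) *
      (shiftedFactorial p m s * shiftedFactorial p m (s + 1) *
        shiftedFactorial p r (-(s + 1))) = (-1) ^ m * shiftedFactorial p (n + m) s := by
  have h := sum_legendreCoeff_div_mul_prod n b hx
  have hp : (p : ℚ) = 2 * n + 1 := by exact_mod_cast hpn
  have hr' : (r : ℚ) + m = n := by exact_mod_cast hr
  have h1 : ∏ j ∈ Finset.range n, ((j : ℚ) + 1 - b) =
      (-1) ^ n * ∏ j ∈ Finset.range n, ((m : ℚ) + j + 1 + p * s) := by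
    rw [← Finset.prod_range_reflect, show (-1 : ℚ) ^ n = ∏ _j ∈ Finset.range n, -1 by simp,
      ← Finset.prod_mul_distrib]
    refine Finset.prod_congr rfl fun j hj => ?_
    have hj' := Finset.mem_range.1 hj
    rw [show n - 1 - j = n - (j + 1) by omega, Nat.cast_sub (by omega), hb]
    push_cast
    ring
  have h2 : ∏ j ∈ Finset.range (n + 1), (b + j) =
      (-1) ^ r * shiftedFactorial p r (-(s + 1)) * (p * (s + 1)) *
        shiftedFactorial p m (s + 1) := by
    rw [show n + 1 = r + 1 + m by omega, Finset.prod_range_add, Finset.prod_range_succ]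
    congr 1
    · congr 1
      · rw [← Finset.prod_range_reflect, shiftedFactorial,
          show (-1 : ℚ) ^ r = ∏ _j ∈ Finset.range r, -1 by simp, ← Finset.prod_mul_distrib]
        refine Finset.prod_congr rfl fun j hj => ?_
        have hj' := Finset.mem_range.1 hj
        rw [show r - 1 - j = r - (j + 1) by omega, Nat.cast_sub (by omega), hb]
        push_cast
        linear_combination hr' - hp
      · rw [hb]
        linear_combination hr' - hp
    · refine Finset.prod_congr rfl fun j _ => ?_
      rw [hb]
      push_cast
      linear_combination hr' - hp
  have h3 : ∑ k ∈ Finset.range (n + 1), legendreCoeff n k * (p / (k + b)) =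
      p * ∑ k ∈ Finset.range (n + 1), legendreCoeff n k / (k + b) := by
    rw [Finset.mul_sum]
    exact Finset.sum_congr rfl fun k _ => by ring
  have h4 : ((-1 : ℚ) ^ r) ^ 2 = 1 := by rw [← pow_mul, mul_comm, pow_mul]; simp
  rw [h1, h2] at h
  rw [h3, ← prod_add_eq_shiftedFactorial]
  rw [← hr, pow_add] at h
  subst hr
  linear_combination ((-1) ^ r * shiftedFactorial p m s) * h +
    ((-1) ^ m * shiftedFactorial p m s *
      ∏ j ∈ Finset.range (r + m), ((m : ℚ) + j + 1 + p * s)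
     - (p * ∑ k ∈ Finset.range (r + m + 1), legendreCoeff (r + m) k / (k + b)) * (s + 1) *
      (shiftedFactorial p m s * shiftedFactorial p m (s + 1) *
        shiftedFactorial p r (-(s + 1)))) * h4

theorem not_dvd_two_of_eq {n : ℕ} (hp : p.Prime) (hpn : p = 2 * n + 1) : ¬ p ∣ 2 := by
  intro h
  have := Nat.le_of_dvd two_pos h
  have := hp.two_le
  omega

theorem isPInt_inv_pow (hp : p.Prime) {n : ℕ} (hpn : p = 2 * n + 1) (k : ℕ) :
    isPInt p ((16 : ℚ) ^ k)⁻¹ := by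
  have h := ((isPInt_inv_nat (not_dvd_two_of_eq hp hpn)).pow hp 4).pow hp k
  have h16 : ((16 : ℚ) ^ k)⁻¹ = (((2 : ℕ) : ℚ)⁻¹ ^ 4) ^ k := by
    rw [← inv_pow]
    norm_num
  rwa [h16]

theorem isPInt_legendreCoeff (hp : p.Prime) (n k : ℕ) : isPInt p (legendreCoeff n k) := by
  have h := isPInt_int hp ((-1) ^ k * n.choose k * (n + k).choose n)
  push_cast at h
  exact h

theorem pCong_centralBinom_legendreCoeff (hp : p.Prime) {n : ℕ} (hpn : p = 2 * n + 1) {k : ℕ}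
    (hk : k ≤ n) :
    pCong p 2 (((2 * k).choose k : ℚ) ^ 2 / 16 ^ k) (legendreCoeff n k) := by
  induction k with
  | zero => simpa [legendreCoeff_zero] using pCong.refl hp 2 1
  | succ k ih =>
    obtain ⟨d, hd, h⟩ := (pCong_iff hp).1 (ih (by omega))
    have h2 : isPInt p (2 : ℚ)⁻¹ := by
      simpa using isPInt_inv_nat (not_dvd_two_of_eq hp hpn)
    have hv : isPInt p ((2 : ℚ)⁻¹ * ((k : ℚ) + 1)⁻¹) :=
      h2.mul hp (isPInt_inv_succ (by omega))
    have hA := legendreCoeff_succ_right (n := n) (k := k) (by omega)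
    have hT : ((k : ℚ) + 1) * (2 * (k + 1)).choose (k + 1) =
        2 * (2 * k + 1) * (2 * k).choose k := by
      have := Nat.succ_mul_centralBinom_succ k
      rw [Nat.centralBinom, Nat.centralBinom] at this
      exact_mod_cast this
    have h0 : (k : ℚ) + 1 ≠ 0 := by positivity
    have hpq : (p : ℚ) = 2 * n + 1 := by exact_mod_cast hpn
    have hT' : ((2 * (k + 1)).choose (k + 1) : ℚ) =
        2 * (2 * k + 1) * (2 * k).choose k / (k + 1) := by
      rw [← hT]; field_simp
    have hA' : legendreCoeff n (k + 1) =
        -legendreCoeff n k * (n + k + 1) * (n - k) / ((k : ℚ) + 1) ^ 2 := by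
      rw [← hA]; field_simp
    refine (pCong_iff hp).2 ⟨d * ((2 * k + 1 : ℕ) * ((2 : ℚ)⁻¹ * ((k : ℚ) + 1)⁻¹)) ^ 2 +
      legendreCoeff n k * ((2 : ℚ)⁻¹ * ((k : ℚ) + 1)⁻¹) ^ 2, ?_, ?_⟩
    · exact (hd.mul hp (((isPInt_nat hp _).mul hp hv).pow hp 2)).add hp
        ((isPInt_legendreCoeff hp n k).mul hp (hv.pow hp 2))
    · have h' : ((2 * k).choose k : ℚ) ^ 2 = (legendreCoeff n k + p ^ 2 * d) * 16 ^ k := by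
        rw [← h]; field_simp
      have h'' : (2 * (2 * k + 1) * (2 * k).choose k / (k + 1) : ℚ) ^ 2 =
          (2 * (2 * k + 1) / (k + 1)) ^ 2 * ((legendreCoeff n k + p ^ 2 * d) * 16 ^ k) := by
        rw [← h']; ring
      rw [hT', hA', h'', hpq]
      push_cast
      field_simp
      ring

theorem nearOne_two_pow (hp : p.Prime) {n : ℕ} (hpn : p = 2 * n + 1) :
    NearOne p (2 ^ (p - 1)) (((2 : ℚ) ^ (p - 1) - 1) / p) := by
  have h0 : (p : ℚ) ≠ 0 := by exact_mod_cast hp.ne_zero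
  have hc : IsCoprime (2 : ℤ) p := by
    have := (Nat.Prime.coprime_iff_not_dvd hp).2 (not_dvd_two_of_eq hp hpn)
    exact_mod_cast (Nat.isCoprime_iff_coprime.2 this).symm
  obtain ⟨c, hc⟩ := (Int.ModEq.pow_card_sub_one_eq_one hp hc).symm.dvd
  have hc' : ((2 : ℚ) ^ (p - 1) - 1) = p * c := by exact_mod_cast hc
  have hq : ((2 : ℚ) ^ (p - 1) - 1) / p = c := by rw [hc']; field_simp
  have h := nearOne_one_add hp (isPInt_int hp c)
  rwa [hq, eq_add_of_sub_eq' hc']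

theorem nearOne_legendreCoeff_self (hp : p.Prime) {n : ℕ} (hpn : p = 2 * n + 1) :
    NearOne p (legendreCoeff n n) (2 * (((2 : ℚ) ^ (p - 1) - 1) / p)) := by
  have h16 := (nearOne_two_pow hp hpn).mul hp (nearOne_two_pow hp hpn)
  rw [← two_mul] at h16
  refine ⟨h16.1, .trans hp ?_ h16.2⟩
  have hpow : (2 : ℚ) ^ (p - 1) * 2 ^ (p - 1) = 16 ^ n := by
    rw [hpn, Nat.add_sub_cancel, pow_mul, ← mul_pow]
    norm_num
  have hnd : ¬ p ∣ (2 * n).choose n := by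
    intro h
    have h1 := Nat.choose_mul_factorial_mul_factorial (show n ≤ 2 * n by omega)
    have h2 : p ∣ (2 * n).factorial := by
      rw [← h1, mul_assoc]; exact h.mul_right _
    have := (Nat.Prime.dvd_factorial hp).1 h2
    omega
  have hne : ((2 * n).choose n : ℚ) ≠ 0 := by
    intro h
    exact hnd (by simp [Nat.cast_eq_zero.1 h])
  have hL : legendreCoeff n n = (-1) ^ n * (2 * n).choose n := by
    rw [legendreCoeff, Nat.choose_self, ← two_mul]; simp
  have hs : ((-1 : ℚ) ^ n) ^ 2 = 1 := by rw [← pow_mul, mul_comm, pow_mul]; simp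
  have hu : isPInt p (16 ^ n * ((-1) ^ n * ((2 * n).choose n : ℚ)⁻¹)) := by
    have h := isPInt_int hp (16 ^ n * (-1) ^ n)
    push_cast at h
    rw [← mul_assoc]
    exact h.mul hp (isPInt_inv_nat hnd)
  have h := (pCong_centralBinom_legendreCoeff hp hpn le_rfl).mul_left hp hu
  rw [hpow]
  rw [hL] at h ⊢
  convert h using 1
  · field_simp
  · field_simp
    exact hs.symm

theorem nearOne_factorial_mul_factorial (hp : p.Prime) {n m r : ℕ} (hpn : p = 2 * n + 1)
    (hr : r + m = n) :
    NearOne p ((-1) ^ m * (n + m).factorial * r.factorial / n.factorial ^ 2)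
      (2 * (((2 : ℚ) ^ (p - 1) - 1) / p) + harmonic r) := by
  induction r generalizing m with
  | zero =>
    obtain rfl : m = n := by omega
    have h0 : (m.factorial : ℚ) ≠ 0 := by positivity
    convert nearOne_legendreCoeff_self hp hpn using 1
    · have := legendreCoeff_mul_factorial (le_refl m)
      rw [← this]
      field_simp
      simp
    · simp
  | succ r ih =>
    have hi := isPInt_inv_succ (p := p) (k := r) (by omega)
    have h := (ih (m := m + 1) (by omega)).mul hp
      ((nearOne_one_add hp (hi.neg hp)).inv hp)
    have h0 : (n.factorial : ℚ) ≠ 0 := by positivity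
    have h1 : ((r : ℚ) + 1) ≠ 0 := by positivity
    have h2 : ((n : ℚ) + m + 1) ≠ 0 := by positivity
    have h3 : (p : ℚ) = n + m + 1 + (r + 1) := by
      exact_mod_cast (by omega : p = n + m + 1 + (r + 1))
    convert h using 1
    · have : (1 + (p : ℚ) * -((r : ℚ) + 1)⁻¹) = -(n + m + 1) / (r + 1) := by
        rw [h3]; field_simp; ring
      rw [this, ← add_assoc, Nat.factorial_succ, Nat.factorial_succ, inv_div]
      push_cast
      field_simp
      ring
    · rw [harmonic_succ]
      push_cast
      ring

theorem pCong_harmonic (hp : p.Prime) {n m r : ℕ} (hpn : p = 2 * n + 1) (hr : r + m = n) :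
    pCong p 1 (harmonic (n + m)) (harmonic r) := by
  induction m generalizing r with
  | zero =>
    obtain rfl : r = n := by omega
    exact pCong.refl hp _ _
  | succ m ih =>
    obtain ⟨d, hd, h⟩ := (pCong_iff hp).1 (ih (r := r + 1) (by omega))
    have h1 := isPInt_inv_succ (p := p) (k := r) (by omega)
    have h2 := isPInt_inv_succ (p := p) (k := n + m) (by omega)
    have h3 : (p : ℚ) = n + m + 1 + (r + 1) := by
      exact_mod_cast (by omega : p = n + m + 1 + (r + 1))
    have h4 : (n : ℚ) + m + 1 ≠ 0 := by positivity
    refine (pCong_iff hp).2 ⟨d + ((r : ℚ) + 1)⁻¹ * (((n + m : ℕ) : ℚ) + 1)⁻¹,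
      hd.add hp (h1.mul hp h2), ?_⟩
    have h5 : ((n : ℚ) + m + 1)⁻¹ + ((r : ℚ) + 1)⁻¹ =
        p * (((r : ℚ) + 1)⁻¹ * ((n : ℚ) + m + 1)⁻¹) := by
      rw [h3]
      field_simp
      ring
    rw [← add_assoc, harmonic_succ, h, harmonic_succ]
    push_cast
    linear_combination h5

theorem add_mul_eq_or_isPInt_inv (hp : p.Prime) {s : ℚ} {a : ℕ} (ha0 : 0 < a)
    (ha : a < 2 * p) (hs : isPInt p s) :
    (a : ℚ) + p * s = p * (s + 1) ∨
      (a : ℚ) + p * s ≠ 0 ∧ isPInt p ((a : ℚ) + p * s)⁻¹ := by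
  by_cases hd : p ∣ a
  · obtain ⟨c, rfl⟩ := hd
    have hc : c = 1 := by
      have h1 := Nat.pos_of_mul_pos_left ha0
      have h2 : c < 2 := by
        by_contra! h
        have := Nat.mul_le_mul_left p h
        omega
      omega
    left
    rw [hc]
    push_cast
    ring
  · right
    refine ⟨?_, isPInt.inv_nat_add_mul hp hd hs⟩
    have h0 : (a : ℚ) ≠ 0 := by positivity
    have h := (hs.mul hp (isPInt_inv_nat hd)).one_add_mul_ne_zero
    intro h'
    apply h
    rw [← mul_left_inj' h0, zero_mul, ← h']
    field_simp

theorem pCong_sum_range_half (hp : p.Prime) {n : ℕ} (hpn : p = 2 * n + 1) {f : ℕ → ℚ}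
    (hf : ∀ k < p, isPInt p (f k)) :
    pCong p 2 (∑ k ∈ Finset.range p, ((2 * k).choose k : ℚ) ^ 2 / 16 ^ k * f k)
      (∑ k ∈ Finset.range (n + 1), ((2 * k).choose k : ℚ) ^ 2 / 16 ^ k * f k) := by
  have h0 : p = n + 1 + n := by omega
  nth_rw 2 [h0]
  rw [Finset.sum_range_add]
  suffices h : ∀ j ∈ Finset.range n, pCong p 2
      (((2 * (n + 1 + j)).choose (n + 1 + j) : ℚ) ^ 2 / 16 ^ (n + 1 + j) * f (n + 1 + j)) 0 by
    simpa using (pCong.refl hp 2 _).add hp (pCong.sum hp _ h)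
  intro j hj
  have hj' := Finset.mem_range.1 hj
  generalize hk : n + 1 + j = k
  obtain ⟨c, hc⟩ : p ∣ (2 * k).choose k := by
    rw [two_mul]
    exact hp.dvd_choose_add (by omega) (by omega) (by omega)
  refine (pCong_iff hp).2 ⟨c ^ 2 * ((16 : ℚ) ^ k)⁻¹ * f k, ?_, ?_⟩
  · exact (((isPInt_nat hp c).pow hp 2).mul hp (isPInt_inv_pow hp hpn k)).mul hp
      (hf k (by omega))
  · rw [hc]
    push_cast
    ring

theorem pCong_sum_legendreCoeff (hp : p.Prime) {n m r : ℕ} (hpn : p = 2 * n + 1)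
    (hr : r + m = n) {b s : ℚ} (hs : isPInt p s) (hs0 : s + 1 ≠ 0)
    (hs1 : isPInt p (s + 1)⁻¹) (hb : b = n + 1 + m + p * s)
    (hx : ∀ k ≤ n, (k : ℚ) + b ≠ 0) :
    pCong p 2 (∑ k ∈ Finset.range (n + 1), legendreCoeff n k * (p / (k + b)))
      ((s + 1)⁻¹ * legendreCoeff n m *
        (1 + p * ((2 * s + 1) * (harmonic r - harmonic m)))) := by
  have hs' := hs.add hp (isPInt_one hp)
  have e1 := nearOne_shiftedFactorial hp (k := n + m) (by omega) hs
  have e2 := nearOne_shiftedFactorial hp (k := m) (by omega) hs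
  have e3 := nearOne_shiftedFactorial hp (k := m) (by omega) hs'
  have e4 := nearOne_shiftedFactorial hp (k := r) (by omega) (hs'.neg hp)
  have e := e1.mul hp (((e2.mul hp e3).mul hp e4).inv hp)
  have hcong : pCong p 1
      (s * harmonic (n + m) + -(s * harmonic m + (s + 1) * harmonic m + -(s + 1) * harmonic r))
      ((2 * s + 1) * (harmonic r - harmonic m)) := by
    obtain ⟨d, hd, h⟩ := (pCong_iff hp).1 (pCong_harmonic hp hpn hr)
    exact (pCong_iff hp).2 ⟨s * d, hs.mul hp hd, by rw [h]; ring⟩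
  have hX := (e.congr hp hcong).2
  have hc := hs1.mul hp (isPInt_legendreCoeff hp n m)
  convert hX.mul_left hp hc using 1
  have h2 := e2.ne_zero hp
  have h3 := e3.ne_zero hp
  have h4 := e4.ne_zero hp
  rw [div_ne_zero_iff] at h2 h3 h4
  have f1 : ((n + m).factorial : ℚ) ≠ 0 := by positivity
  have hS := sum_legendreCoeff_mul_shiftedFactorial hr hpn hb hx
  have hL : legendreCoeff n m =
      (-1) ^ m * (n + m).factorial / (m.factorial ^ 2 * r.factorial) := by
    have := legendreCoeff_mul_factorial (n := n) (m := m) (by omega)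
    rw [show n - m = r by omega] at this
    rw [← this]
    have := h2.2
    have := h4.2
    field_simp
  rw [hL, ← mul_left_inj' hs0, ← mul_left_inj' h2.1, ← mul_left_inj' h3.1,
    ← mul_left_inj' h4.1]
  refine Eq.trans (by ring) (hS.trans ?_)
  obtain ⟨g2, k2⟩ := h2
  obtain ⟨g3, -⟩ := h3
  obtain ⟨g4, k4⟩ := h4
  field_simp

end

theorem stmt12 (p : ℕ) (hp : p.Prime) (hodd : Odd p) (b : ℚ) (B : ℕ)
    (hb : isPInt p b) (hB : B < p) (hbB : pCong p 1 b (B : ℚ))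
    (hBgt : p < 2 * B)
    (hs : ¬ pCong p 1 ((b - B) / p) (-1)) :
    pCong p 2
      (∑ k ∈ Finset.range p,
        ((2 * k).choose k : ℚ) ^ 2 / 16 ^ k * ((p : ℚ) / ((k : ℚ) + b)))
      (∑ k ∈ Finset.range ((p - 1) / 2 + 1),
        ((2 * k).choose k : ℚ) ^ 2 / 16 ^ k * ((p : ℚ) / ((k : ℚ) + b))) ∧
    pCong p 2
      (∑ k ∈ Finset.range ((p - 1) / 2 + 1),
        ((2 * k).choose k : ℚ) ^ 2 / 16 ^ k * ((p : ℚ) / ((k : ℚ) + b)))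
      ((((2 * (B - (p + 1) / 2)).choose (B - (p + 1) / 2) : ℚ) ^ 2 /
          ((((b - B) / p) + 1) * 16 ^ (B - (p + 1) / 2))) *
        (1 + (p : ℚ) * (2 * ((b - B) / p) + 1) *
          (harmonic (p - B) - harmonic (B - (p + 1) / 2)))) ∧
    pCong p 2
      ((((2 * (B - (p + 1) / 2)).choose (B - (p + 1) / 2) : ℚ) ^ 2 /
          ((((b - B) / p) + 1) * 16 ^ (B - (p + 1) / 2))) *
        (1 + (p : ℚ) * (2 * ((b - B) / p) + 1) *
          (harmonic (p - B) - harmonic (B - (p + 1) / 2))))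
      ((1 / (((b - B) / p) + 1)) * (((p - 1) / 2).choose (p - B) : ℚ) ^ 2 *
        (1 + (p : ℚ) * (2 * (((2 : ℚ) ^ (p - 1) - 1) / (p : ℚ))
          + (2 * ((b - B) / p) + 2) * harmonic (p - B)
          - (2 * ((b - B) / p) + 1) * harmonic (B - (p + 1) / 2)))) := by
  obtain ⟨n, hpn⟩ := hodd
  obtain ⟨m, rfl⟩ : ∃ m, B = n + 1 + m := ⟨B - (n + 1), by omega⟩
  obtain ⟨r, hr⟩ : ∃ r, r + m = n := ⟨n - m, by omega⟩
  rw [show (p - 1) / 2 = n by omega, show (p + 1) / 2 = n + 1 by omega,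
    show n + 1 + m - (n + 1) = m by omega, show p - (n + 1 + m) = r by omega]
  have hp0 : (p : ℚ) ≠ 0 := by exact_mod_cast hp.ne_zero
  have hsInt : isPInt p ((b - (n + 1 + m : ℕ)) / p) := by simpa [pCong] using hbB
  have hb' : b = (n + 1 + m : ℕ) + p * ((b - (n + 1 + m : ℕ)) / p) := by
    rw [mul_div_cancel₀ _ hp0]
    ring
  generalize (b - (n + 1 + m : ℕ)) / p = s at *
  rw [pCong, pow_one, sub_neg_eq_add] at hs
  have hs1 : isPInt p (s + 1)⁻¹ :=
    (hsInt.add hp (isPInt_one hp)).inv_of_not_isPInt_div hp hs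
  have hs0 : s + 1 ≠ 0 := by
    intro h
    exact hs (by simpa [h] using isPInt_nat hp 0)
  have hkb : ∀ k < p, (k : ℚ) + b ≠ 0 ∧ isPInt p ((p : ℚ) / (k + b)) := by
    intro k hk
    have h : (k : ℚ) + b = ((k + (n + 1 + m) : ℕ) : ℚ) + p * s := by
      rw [hb']
      push_cast
      ring
    rw [h]
    rcases add_mul_eq_or_isPInt_inv hp (a := k + (n + 1 + m)) (by omega) (by omega) hsInt with
      h | ⟨h, hi⟩
    · rw [h, div_mul_cancel_left₀ hp0]
      exact ⟨mul_ne_zero hp0 hs0, hs1⟩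
    · exact ⟨h, (isPInt_nat hp p).mul hp hi⟩
  have hmid := pCong_centralBinom_legendreCoeff hp hpn (show m ≤ n by omega)
  have hHr := isPInt_harmonic hp (k := r) (by omega)
  have hHm := isPInt_harmonic hp (k := m) (by omega)
  have h21 := ((isPInt_two hp).mul hp hsInt).add hp (isPInt_one hp)
  have hN := nearOne_one_add hp (h21.mul hp (hHr.sub hp hHm))
  have hNint : isPInt p (1 + p * ((2 * s + 1) * (harmonic r - harmonic m))) :=
    (isPInt_one hp).add hp ((isPInt_nat hp p).mul hp hN.1)
  have hT := ((hmid.mul_left hp hs1).mul_right hp hNint).symm hp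
  refine ⟨pCong_sum_range_half hp hpn fun k hk => (hkb k hk).2, ?_, ?_⟩
  · refine .trans hp (.sum hp _ (g := fun k : ℕ => legendreCoeff n k * ((p : ℚ) / (k + b)))
      fun k hk => ?_) (.trans hp (pCong_sum_legendreCoeff hp hpn hr hsInt hs0 hs1 ?_ ?_)
        (.trans hp hT ?_))
    · have hk' := Finset.mem_range.1 hk
      exact (pCong_centralBinom_legendreCoeff hp hpn (by omega)).mul_right hp
        (hkb k (by omega)).2
    · rw [hb']
      push_cast
      ring
    · exact fun k hk => (hkb k (by omega)).1
    · convert pCong.refl hp 2 _ using 1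
      field_simp
  · have hF := nearOne_factorial_mul_factorial hp hpn hr
    have hC := (isPInt_nat hp (n.choose r)).pow hp 2
    have h3 := (hF.mul hp hN).2.mul_left hp (hs1.mul hp hC)
    refine .trans hp ?_ (.trans hp (hT.symm hp) (.trans hp ?_ (.trans hp h3 ?_)))
    · convert pCong.refl hp 2 _ using 1
      field_simp
    · convert pCong.refl hp 2 _ using 1
      have h1 := legendreCoeff_mul_factorial (show m ≤ n by omega)
      have h2 : (n.choose r * r.factorial * m.factorial : ℚ) = n.factorial := by
        have := Nat.choose_mul_factorial_mul_factorial (show r ≤ n by omega)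
        rw [show n - r = m by omega] at this
        exact_mod_cast this
      rw [show n - m = r by omega] at h1
      have hm0 : (m.factorial : ℚ) ≠ 0 := by positivity
      have hr0 : (r.factorial : ℚ) ≠ 0 := by positivity
      have hc0 : (n.choose r : ℚ) ≠ 0 := by
        exact_mod_cast (Nat.choose_pos (show r ≤ n by omega)).ne'
      rw [← h1, ← h2]
      field_simp
    · convert pCong.refl hp 2 _ using 1
      field_simp
      ring
end

section
/- Let p be a prime with p ≡ 1 (mod 3), and let x, y be integers with p = x² + 3y². Then Σ_{k=0}^{p−1} ( C(2k,k)²/16^k ) · p/(3k + 1) ≡ Σ_{k=0}^{p−1} ( C(2k,k)²/16^k ) · p/(6k + 1) ≡ 4x² − 2p (mod p²). -/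
section JacobiSum
open Finset

theorem exists_teichmullerChar (p : ℕ) [Fact p.Prime] :
    ∃ ω : MulChar (ZMod p) ℤ_[p], ∀ a, PadicInt.toZMod (ω a) = a := by
  have key : ∀ x : WittVector p (ZMod p),
      PadicInt.toZMod (WittVector.equiv p x) = WittVector.constantCoeff x := by
    intro x
    obtain ⟨y, rfl⟩ := (WittVector.equiv p).symm.surjective x
    rw [RingEquiv.apply_symm_apply]
    have hy : y - (PadicInt.zmodRepr y : ℤ_[p]) ∈ IsLocalRing.maximalIdeal ℤ_[p] :=
      PadicInt.sub_zmodRepr_mem y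
    rw [PadicInt.maximalIdeal_eq_span_p, Ideal.mem_span_singleton] at hy
    obtain ⟨c, hc⟩ := hy
    have hy' : y = (PadicInt.zmodRepr y : ℤ_[p]) + p * c := by rw [← hc]; ring
    rw [hy']
    simp only [map_add, map_mul, map_natCast, CharP.cast_eq_zero, zero_mul]
  refine ⟨⟨((WittVector.equiv p).toRingHom.toMonoidHom).comp (WittVector.teichmuller p), ?_⟩, ?_⟩
  · intro a ha
    have : a = 0 := by simpa using ha
    subst this
    simp [WittVector.teichmuller_zero]
  · intro a
    exact (key _).trans (WittVector.teichmuller_coeff_zero p a)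

theorem sum_mul_apply_sub {F R : Type*} [Field F] [Fintype F] [CommRing R] [IsDomain R]
    {χ ψ : MulChar F R} (h : χ * ψ ≠ 1) (s : F) :
    ∑ a, χ a * ψ (s - a) = (χ * ψ) s * jacobiSum χ ψ := by
  classical
  rcases eq_or_ne s 0 with rfl | hs
  · rw [MulChar.map_zero, zero_mul]
    have : ∀ a, χ a * ψ (0 - a) = ψ (-1) * (χ * ψ) a := fun a => by
      rw [zero_sub, neg_eq_neg_one_mul, map_mul, MulChar.mul_apply]; ring
    simp_rw [this]
    rw [← mul_sum, MulChar.sum_eq_zero_of_ne_one h, mul_zero]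
  · rw [jacobiSum, mul_sum, ← Equiv.sum_comp (Equiv.mulLeft₀ s hs)]
    refine sum_congr rfl fun a _ => ?_
    change χ (s * a) * ψ (s - s * a) = _
    rw [← mul_one_sub, map_mul, map_mul, MulChar.mul_apply]; ring

theorem jacobiSum_mul_jacobiSum_mul {F R : Type*} [Field F] [Fintype F] [CommRing R] [IsDomain R]
    {χ ψ ρ : MulChar F R} (h₁ : χ * ψ ≠ 1) (h₂ : ψ * ρ ≠ 1) :
    jacobiSum χ ψ * jacobiSum (χ * ψ) ρ = jacobiSum χ (ψ * ρ) * jacobiSum ψ ρ := by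
  have e₁ : jacobiSum χ ψ * jacobiSum (χ * ψ) ρ =
      ∑ s, ∑ a, χ a * ψ (s - a) * ρ (1 - s) := by
    conv_lhs => enter [2]; rw [jacobiSum]
    rw [mul_sum]
    refine sum_congr rfl fun s _ => ?_
    rw [← sum_mul, sum_mul_apply_sub h₁]; ring
  have e₂ : jacobiSum χ (ψ * ρ) * jacobiSum ψ ρ =
      ∑ a, ∑ s, χ a * ψ (s - a) * ρ (1 - s) := by
    conv_lhs => enter [1]; rw [jacobiSum]
    rw [sum_mul]
    refine sum_congr rfl fun a _ => ?_
    rw [mul_assoc, ← sum_mul_apply_sub h₂, mul_sum, ← Equiv.sum_comp (Equiv.addRight a)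
      (fun s => χ a * ψ (s - a) * ρ (1 - s))]
    refine sum_congr rfl fun b _ => ?_
    simp only [Equiv.coe_addRight, add_sub_cancel_right]
    rw [mul_assoc, sub_sub, add_comm a b]
  rw [e₁, e₂, sum_comm]

section Teich
variable {p : ℕ} [Fact p.Prime] {ω : MulChar (ZMod p) ℤ_[p]}

theorem teichmullerChar_pow_eq_one_iff (hω : ∀ a, PadicInt.toZMod (ω a) = a) (k : ℕ) :
    ω ^ k = 1 ↔ p - 1 ∣ k := by
  have h : ω ^ k = 1 ↔ ∀ a : (ZMod p)ˣ, a ^ k = 1 := by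
    constructor
    · intro h a
      have := congrArg (fun χ : MulChar (ZMod p) ℤ_[p] => PadicInt.toZMod (χ a)) h
      simp only [MulChar.pow_apply_coe, map_pow, hω, MulChar.one_apply_coe, map_one] at this
      ext; simpa using this
    · intro h
      ext a
      rw [MulChar.pow_apply_coe, ← map_pow, ← Units.val_pow_eq_pow_val, h a]
      simp
  rw [h, FiniteField.forall_pow_eq_one_iff, ZMod.card]

theorem sum_teichmullerChar_pow (hω : ∀ a, PadicInt.toZMod (ω a) = a) {k : ℕ} (hk : k ≠ 0) :
    ∑ a, ω a ^ k = if p - 1 ∣ k then (p - 1 : ℤ_[p]) else 0 := by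
  have : ∀ a, ω a ^ k = (ω ^ k) a := fun a => (MulChar.pow_apply' ω hk a).symm
  simp_rw [this]
  split_ifs with h
  · rw [(teichmullerChar_pow_eq_one_iff hω k).2 h, MulChar.sum_one_eq_card_units,
      ZMod.card_units_eq_totient, Nat.totient_prime Fact.out,
      Nat.cast_sub (Fact.out : p.Prime).one_le, Nat.cast_one]
  · exact MulChar.sum_eq_zero_of_ne_one (mt (teichmullerChar_pow_eq_one_iff hω k).1 h)

theorem exists_one_add_pow_eq {R : Type*} [CommRing R] (x : R) (n : ℕ) :
    ∃ r, (1 + x) ^ n = 1 + n * x + n.choose 2 * x ^ 2 + r * x ^ 3 := by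
  induction n with
  | zero => exact ⟨0, by simp⟩
  | succ n ih =>
    obtain ⟨r, hr⟩ := ih
    refine ⟨n.choose 2 + r + r * x, ?_⟩
    rw [pow_succ, hr, Nat.choose_succ_succ' n 1, Nat.choose_one_right]
    push_cast; ring

theorem toZMod_eq_zero_iff_dvd (x : ℤ_[p]) : PadicInt.toZMod x = 0 ↔ (p : ℤ_[p]) ∣ x := by
  rw [← RingHom.mem_ker, PadicInt.ker_toZMod, PadicInt.maximalIdeal_eq_span_p,
    Ideal.mem_span_singleton]

theorem mulChar_zmod_apply_pow_prime (ω : MulChar (ZMod p) ℤ_[p]) (a : ZMod p) :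
    ω a ^ p = ω a := by
  rw [← map_pow, ZMod.pow_card]

theorem dvd_teichmullerChar_one_sub (hω : ∀ a, PadicInt.toZMod (ω a) = a) (a : ZMod p)
    (hp2 : p ≠ 2) :
    (p : ℤ_[p]) ^ 3 ∣ ω (1 - a) -
      ((1 - ω a) + (1 + p) * ((1 - ω a) ^ p - (1 - ω a))) := by
  have hp : p.Prime := Fact.out
  rcases eq_or_ne a 1 with rfl | ha
  · simp [hp.ne_zero, MulChar.map_zero]
  set z := 1 - ω a with hz
  have hz0 : PadicInt.toZMod z ≠ 0 := by
    rw [hz, map_sub, hω, map_one, sub_ne_zero]; exact ha.symm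
  obtain ⟨e, he⟩ : (p : ℤ_[p]) ∣ z ^ (p - 1) - 1 := by
    rw [← toZMod_eq_zero_iff_dvd, map_sub, map_pow, ZMod.pow_card_sub_one_eq_one hz0]; simp
  have hzp : z ^ p = z * (1 + p * e) := by
    rw [← he, ← pow_sub_one_mul hp.ne_zero z]; ring
  have h1 : (p : ℤ_[p]) ∣ ω (1 - a) - z := by
    rw [← toZMod_eq_zero_iff_dvd, map_sub, hω, hz, map_sub, hω]; simp
  have h2 : (p : ℤ_[p]) ^ 3 ∣ ω (1 - a) - z ^ p ^ 2 := by
    have := dvd_sub_pow_of_dvd_sub h1 2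
    rwa [pow_two p, pow_mul, pow_mul, mulChar_zmod_apply_pow_prime, mulChar_zmod_apply_pow_prime,
      ← pow_mul, ← pow_two p] at this
  obtain ⟨r, hr⟩ := exists_one_add_pow_eq ((p : ℤ_[p]) * e) p
  obtain ⟨c, hc⟩ : p ∣ p.choose 2 := hp.dvd_choose_self two_ne_zero (by
    have := hp.two_le; omega)
  have h3 : (p : ℤ_[p]) ^ 3 ∣ z ^ p ^ 2 - (z + (1 + p) * (z ^ p - z)) := by
    rw [pow_two p, pow_mul, hzp, mul_pow, hzp, hr, hc]
    refine ⟨z * (e ^ 2 + c * e ^ 2 + r * e ^ 3 + p * (c * e ^ 3 + r * e ^ 4)), ?_⟩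
    push_cast; ring
  have := dvd_add h2 h3
  rwa [sub_add_sub_cancel] at this

theorem dvd_add_mul_jacobiSum_teichmullerChar (hω : ∀ a, PadicInt.toZMod (ω a) = a) {i : ℕ}
    (hi : 1 ≤ i) (hip : i + 2 < p) :
    (p : ℤ_[p]) ^ 3 ∣ (i + 1) * jacobiSum (ω ^ i) ω + p * ((-1) ^ i * (p - 1).choose i) := by
  have hp : p.Prime := Fact.out
  have hodd : Odd p := hp.odd_of_ne_two (by omega)
  have h0 : ∀ k, 1 ≤ k → k < p - 1 → ∑ a, ω a ^ k = 0 := fun k h1 h2 => by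
    rw [sum_teichmullerChar_pow hω (by omega), if_neg (Nat.not_dvd_of_pos_of_lt h1 h2)]
  have hD : ∑ a, ω a ^ i * (1 - ω a) ^ p = (p - 1) * ((-1) ^ i * p.choose (i + 1)) := by
    have e : ∀ a, ω a ^ i * (1 - ω a) ^ p =
        ∑ k ∈ range (p + 1), (-1) ^ k * p.choose k * ω a ^ (i + k) := fun a => by
      rw [sub_eq_neg_add, add_pow, mul_sum]
      refine sum_congr rfl fun k _ => ?_
      rw [neg_pow, one_pow, pow_add]; ring
    simp_rw [e]
    rw [sum_comm]
    simp_rw [← mul_sum]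
    rw [sum_range_succ, sum_eq_single_of_mem (p - 1 - i) (by simp; omega)]
    · rw [sum_teichmullerChar_pow hω (by omega), if_pos (by
        rw [Nat.add_sub_cancel' (by omega)]), show i + p = (i + 1) + (p - 1) by omega]
      have : ∑ a, ω a ^ (i + 1 + (p - 1)) = ∑ a, ω a ^ (i + 1) := by
        refine sum_congr rfl fun a _ => ?_
        rw [add_assoc, add_comm 1, Nat.sub_add_cancel hp.one_le, pow_add,
          mulChar_zmod_apply_pow_prime, pow_succ]
      rw [this, h0 _ (by omega) (by omega)]
      have hc : p.choose (p - 1 - i) = p.choose (i + 1) := by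
        rw [← Nat.choose_symm (show i + 1 ≤ p by omega)]; congr 1; omega
      have hs : (-1 : ℤ_[p]) ^ (p - 1 - i) = (-1) ^ i := by
        have he : Even (p - 1) := hodd.tsub_odd odd_one
        rcases Nat.even_or_odd i with h | h
        · rw [h.neg_one_pow, Even.neg_one_pow]
          exact (Nat.even_sub (by omega)).2 (by tauto)
        · rw [h.neg_one_pow, Odd.neg_one_pow]
          exact (Nat.odd_sub' (by omega)).2 (by tauto)
      rw [hc, hs]; ring
    · intro k hk hne
      rw [mem_range] at hk
      rw [sum_teichmullerChar_pow hω (by omega), if_neg, mul_zero]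
      rintro ⟨c, hc⟩
      have h2 : (p - 1) * c < (p - 1) * 2 := by omega
      have h3 : c < 2 := lt_of_mul_lt_mul_left h2 (Nat.zero_le _)
      interval_cases c <;> omega
  have hsum : ∑ a, ω a ^ i * ((1 - ω a) + (1 + p) * ((1 - ω a) ^ p - (1 - ω a))) =
      (1 + p) * ((p - 1) * ((-1) ^ i * p.choose (i + 1))) := by
    rw [← hD, mul_sum]
    have : ∀ a, ω a ^ i * ((1 - ω a) + (1 + p) * ((1 - ω a) ^ p - (1 - ω a))) =
        (1 + p) * (ω a ^ i * (1 - ω a) ^ p) - p * (ω a ^ i) + p * ω a ^ (i + 1) := fun a => by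
      ring
    simp_rw [this]
    rw [sum_add_distrib, sum_sub_distrib, ← mul_sum univ (fun a => ω a ^ i),
      ← mul_sum univ (fun a => ω a ^ (i + 1)),
      h0 i hi (by omega), h0 (i + 1) (by omega) (by omega)]
    ring
  have hmain : (p : ℤ_[p]) ^ 3 ∣ jacobiSum (ω ^ i) ω -
      (1 + p) * ((p - 1) * ((-1) ^ i * p.choose (i + 1))) := by
    rw [← hsum, jacobiSum, ← sum_sub_distrib]
    refine dvd_sum fun a _ => ?_
    rw [MulChar.pow_apply' _ (by omega), ← mul_sub]
    exact Dvd.dvd.mul_left (dvd_teichmullerChar_one_sub hω a (by omega)) _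
  have hch : ((i : ℤ_[p]) + 1) * p.choose (i + 1) = p * (p - 1).choose i := by
    have := Nat.add_one_mul_choose_eq (p - 1) i
    rw [Nat.sub_add_cancel hp.one_le] at this
    have := congrArg (Nat.cast : ℕ → ℤ_[p]) this
    push_cast at this
    linear_combination -this
  obtain ⟨c, hc⟩ := hmain
  refine ⟨(i + 1) * c + (-1) ^ i * (p - 1).choose i, ?_⟩
  linear_combination ((i : ℤ_[p]) + 1) * hc + (p ^ 2 - 1) * (-1) ^ i * hch
end Teich

section Harmonic
open Nat

/-- The `n`-th harmonic number modulo `p ^ 2`. -/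
def harmonicModSq (p n : ℕ) : ZMod (p ^ 2) := ∑ i ∈ range n, ((i + 1 : ℕ) : ZMod (p ^ 2))⁻¹

variable {p : ℕ} [Fact p.Prime]

theorem natCast_sq_eq_zero_zmod_sq (p : ℕ) : (p : ZMod (p ^ 2)) ^ 2 = 0 := by
  rw [← Nat.cast_pow, ZMod.natCast_self]

theorem isUnit_natCast_zmod_sq {n : ℕ} (h0 : n ≠ 0) (h : n < p) :
    IsUnit (n : ZMod (p ^ 2)) := by
  rw [ZMod.isUnit_iff_coprime]
  exact (Nat.coprime_of_lt_prime h0 h Fact.out).symm.pow_right 2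

theorem isUnit_factorial_zmod_sq {n : ℕ} (h : n < p) : IsUnit (n ! : ZMod (p ^ 2)) := by
  rw [ZMod.isUnit_iff_coprime]
  have hp : p.Prime := Fact.out
  exact ((Nat.coprime_factorial_iff hp.ne_one).2 (by rwa [hp.minFac_eq])).symm.pow_right 2

theorem mul_harmonicModSq_succ {n : ℕ} (h : n + 1 < p) :
    (n + 1) * harmonicModSq p (n + 1) = (n + 1) * harmonicModSq p n + 1 := by
  rw [harmonicModSq, sum_range_succ, ← harmonicModSq, mul_add, ← Nat.cast_add_one,
    ZMod.coe_mul_inv_eq_one]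
  exact (Nat.coprime_of_lt_prime (Nat.succ_ne_zero n) h Fact.out).symm.pow_right 2

theorem neg_one_pow_mul_choose_zmod_sq {n : ℕ} (h : n < p) :
    (-1) ^ n * ((p - 1).choose n : ZMod (p ^ 2)) = 1 - p * harmonicModSq p n := by
  induction n with
  | zero => simp [harmonicModSq]
  | succ n ih =>
    have hc := congrArg (Nat.cast : ℕ → ZMod (p ^ 2)) (Nat.choose_succ_right_eq (p - 1) n)
    rw [Nat.cast_mul, Nat.cast_mul, Nat.cast_sub (by omega), Nat.cast_sub (by omega)] at hc
    apply (isUnit_natCast_zmod_sq n.succ_ne_zero h).mul_left_cancel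
    have h2 := mul_harmonicModSq_succ h
    have hp := natCast_sq_eq_zero_zmod_sq p
    have ih := ih (by omega)
    push_cast at hc ⊢
    linear_combination -(-1) ^ n * hc - (p - 1 - n : ZMod (p ^ 2)) * ih + p * h2
      + harmonicModSq p n * hp

theorem mul_harmonicModSq_reflect (hodd : Odd p) {n k : ℕ} (h : n + k + 1 = p) :
    (p : ZMod (p ^ 2)) * harmonicModSq p k = p * harmonicModSq p n := by
  have h1 := neg_one_pow_mul_choose_zmod_sq (p := p) (n := n) (by omega)
  have h2 := neg_one_pow_mul_choose_zmod_sq (p := p) (n := k) (by omega)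
  have hc : (p - 1).choose n = (p - 1).choose k := by
    rw [← Nat.choose_symm (show k ≤ p - 1 by omega)]; congr 1; omega
  have hs : (-1 : ZMod (p ^ 2)) ^ n = (-1) ^ k := by
    have : Even (n + k) := by rw [← h] at hodd; simpa [Nat.odd_add_one] using hodd
    rcases Nat.even_or_odd n with hn | hn
    · rw [hn.neg_one_pow, ((Nat.even_add.1 this).1 hn).neg_one_pow]
    · rw [hn.neg_one_pow, ((Nat.even_add'.1 this).1 hn).neg_one_pow]
  rw [hc, hs, h2] at h1
  linear_combination -h1

theorem factorial_mul_factorial_zmod_sq {n k : ℕ} (h : n + k + 1 = p) :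
    (n ! * k ! : ZMod (p ^ 2)) * (1 - p * harmonicModSq p n) = (-1) ^ n * (p - 1)! := by
  rw [← neg_one_pow_mul_choose_zmod_sq (by omega),
    ← Nat.choose_mul_factorial_mul_factorial (show n ≤ p - 1 by omega),
    show p - 1 - n = k by omega]
  push_cast; ring

theorem mul_prod_range_zmod_sq (c e : ZMod (p ^ 2)) {n : ℕ} (h : n < p) :
    c * ∏ d ∈ range n, (c * ((d : ZMod (p ^ 2)) + 1) + e * (p : ZMod (p ^ 2))) =
      c ^ n * (n ! : ZMod (p ^ 2)) * (c + e * ((p : ZMod (p ^ 2)) * harmonicModSq p n)) := by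
  induction n with
  | zero => simp [harmonicModSq]
  | succ n ih =>
    rw [prod_range_succ, ← mul_assoc, ih (by omega), Nat.factorial_succ]
    have h2 := mul_harmonicModSq_succ h
    have hp := natCast_sq_eq_zero_zmod_sq p
    push_cast
    linear_combination c ^ n * (n ! : ZMod (p ^ 2)) *
      (e ^ 2 * harmonicModSq p n * hp - c * e * (p : ZMod (p ^ 2)) * h2)

variable {ω : MulChar (ZMod p) ℤ_[p]}

theorem exists_jacobiSum_teichmullerChar_eq_mul (hω : ∀ a, PadicInt.toZMod (ω a) = a) {i : ℕ}
    (hi : 1 ≤ i) (hip : i + 2 < p) :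
    ∃ u, jacobiSum (ω ^ i) ω = p * u ∧
      (i + 1) * PadicInt.toZModPow 2 u = -(1 - p * harmonicModSq p i) := by
  obtain ⟨c, hc⟩ := dvd_add_mul_jacobiSum_teichmullerChar hω hi hip
  have hp0 : (p : ℤ_[p]) ≠ 0 := PadicInt.prime_p.ne_zero
  have hi1 : ¬ (p : ℤ_[p]) ∣ (i + 1 : ℕ) := by
    rw [← toZMod_eq_zero_iff_dvd, map_natCast, ZMod.natCast_eq_zero_iff]
    exact Nat.not_dvd_of_pos_of_lt (by omega) (by omega)
  obtain ⟨u, hu⟩ : (p : ℤ_[p]) ∣ jacobiSum (ω ^ i) ω := by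
    refine (PadicInt.prime_p.dvd_mul.1 ?_).resolve_left hi1
    refine ⟨p ^ 2 * c - (-1) ^ i * (p - 1).choose i, ?_⟩
    push_cast
    linear_combination hc
  refine ⟨u, hu, ?_⟩
  have h : (i + 1) * u + (-1) ^ i * (p - 1).choose i = p ^ 2 * c := by
    apply mul_left_cancel₀ hp0
    rw [hu] at hc
    linear_combination hc
  have h2 := congrArg (PadicInt.toZModPow 2) h
  simp only [map_add, map_mul, map_natCast, map_one, map_pow, map_neg,
    natCast_sq_eq_zero_zmod_sq, zero_mul, neg_one_pow_mul_choose_zmod_sq (show i < p by omega)] at h2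
  linear_combination h2

theorem exists_jacobiSum_teichmullerChar_pow_eq_mul (hω : ∀ a, PadicInt.toZMod (ω a) = a)
    {i : ℕ} (hi : 1 ≤ i) (j : ℕ) (hij : i + j + 2 < p) :
    ∃ u, jacobiSum (ω ^ i) (ω ^ (j + 1)) = p * u ∧
      (i ! * (j + 1)! : ZMod (p ^ 2)) * (1 - p * ((i + j + 1) * harmonicModSq p (i + j + 1)
        - i * harmonicModSq p i - (j + 1) * harmonicModSq p (j + 1))) =
      -((i + j + 1)! * PadicInt.toZModPow 2 u) := by
  have hp2 := natCast_sq_eq_zero_zmod_sq p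
  have hp0 : (p : ℤ_[p]) ≠ 0 := PadicInt.prime_p.ne_zero
  have hne : ∀ k, 1 ≤ k → k < p - 1 → ω ^ k ≠ 1 := fun k h1 h2 h =>
    Nat.not_dvd_of_pos_of_lt h1 h2 ((teichmullerChar_pow_eq_one_iff hω k).1 h)
  induction j with
  | zero =>
    obtain ⟨u, hu, h⟩ := exists_jacobiSum_teichmullerChar_eq_mul hω hi hij
    refine ⟨u, by simpa using hu, ?_⟩
    have h2 := mul_harmonicModSq_succ (p := p) (n := i) (by omega)
    have h3 := mul_harmonicModSq_succ (p := p) (n := 0) (by omega)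
    have h4 : harmonicModSq p 0 = 0 := by simp [harmonicModSq]
    simp only [Nat.cast_zero, zero_add, add_zero, Nat.factorial_succ, h4] at h3 ⊢
    push_cast
    linear_combination (i ! : ZMod (p ^ 2)) * (h + (-p) * h2 + p * h3)
  | succ j ih =>
    obtain ⟨u, hu, h⟩ := ih (by omega)
    obtain ⟨u₁, hu₁, h₁⟩ := exists_jacobiSum_teichmullerChar_eq_mul hω
      (show 1 ≤ i + (j + 1) by omega) (by omega)
    obtain ⟨u₂, hu₂, h₂⟩ := exists_jacobiSum_teichmullerChar_eq_mul hω
      (show 1 ≤ j + 1 by omega) (by omega)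
    have hJ : jacobiSum (ω ^ i) (ω ^ (j + 1)) * jacobiSum (ω ^ (i + (j + 1))) ω =
        jacobiSum (ω ^ i) (ω ^ (j + 1 + 1)) * jacobiSum (ω ^ (j + 1)) ω := by
      rw [pow_add ω i, pow_succ ω (j + 1)]
      apply jacobiSum_mul_jacobiSum_mul
      · rw [← pow_add]; exact hne _ (by omega) (by omega)
      · rw [← pow_succ]; exact hne _ (by omega) (by omega)
    rw [hu, hu₁, hu₂] at hJ
    have hJ' : p * (u * u₁) = jacobiSum (ω ^ i) (ω ^ (j + 1 + 1)) * u₂ := by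
      apply mul_left_cancel₀ hp0
      linear_combination hJ
    have hu₂' : ¬ (p : ℤ_[p]) ∣ u₂ := by
      rintro ⟨t, rfl⟩
      rw [map_mul, map_natCast] at h₂
      have : (p : ZMod (p ^ 2)) = 0 := by
        linear_combination p * h₂ -
          (((j + 1 : ℕ) : ZMod (p ^ 2)) + 1) * PadicInt.toZModPow 2 t * hp2
            + harmonicModSq p (j + 1) * hp2
      rw [ZMod.natCast_eq_zero_iff] at this
      have h1 := Nat.le_of_dvd (by omega) this
      nlinarith
    obtain ⟨v, hv⟩ := (PadicInt.prime_p.dvd_mul.1 ⟨_, hJ'.symm⟩).resolve_right hu₂'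
    refine ⟨v, hv, ?_⟩
    have hvu : u * u₁ = v * u₂ := by
      apply mul_left_cancel₀ hp0
      rw [hJ', hv, mul_assoc]
    have hvu := congrArg (PadicInt.toZModPow 2) hvu
    rw [map_mul, map_mul] at hvu
    have hunit : IsUnit ((1 : ZMod (p ^ 2)) - p * harmonicModSq p (j + 1)) :=
      IsUnit.of_mul_eq_one (1 + p * harmonicModSq p (j + 1)) (by
        linear_combination -harmonicModSq p (j + 1) ^ 2 * hp2)
    apply hunit.mul_left_cancel
    have e1 := mul_harmonicModSq_succ (p := p) (n := j + 1) (by omega)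
    have e2 := mul_harmonicModSq_succ (p := p) (n := i + j + 1) (by omega)
    rw [← add_assoc] at h₁
    rw [show i + (j + 1) + 1 = i + j + 1 + 1 by ring, Nat.factorial_succ (j + 1),
      Nat.factorial_succ (i + j + 1)]
    push_cast at h₁ h₂ h e1 e2 ⊢
    generalize PadicInt.toZModPow 2 u = U at *
    generalize PadicInt.toZModPow 2 u₁ = U₁ at *
    generalize PadicInt.toZModPow 2 u₂ = U₂ at *
    generalize PadicInt.toZModPow 2 v = V at *
    generalize harmonicModSq p (j + 1 + 1) = Hj' at *
    generalize harmonicModSq p (i + j + 1 + 1) = Hk' at *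
    generalize harmonicModSq p (j + 1) = Hj at *
    generalize harmonicModSq p (i + j + 1) = Hk at *
    generalize harmonicModSq p i = Hi at *
    linear_combination (i ! : ZMod (p ^ 2)) * (((j : ZMod (p ^ 2)) + 1 + 1) * (j + 1)!) *
        (-p * e2 + p * e1 + (Hj * ((i + (j + 1) + 1) * Hk' - i * Hi - (j + 1 + 1) * Hj')
          - ((i + j + 1) * Hk - i * Hi - (j + 1) * Hj) * Hk) * hp2)
      + ((i : ZMod (p ^ 2)) + j + 1 + 1) * (i + j + 1)! * V * h₂
      + ((j : ZMod (p ^ 2)) + 1 + 1) * (i + j + 1 + 1) * (i + j + 1)! * hvu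
      - ((j : ZMod (p ^ 2)) + 1 + 1) * (i + j + 1)! * U * h₁
      + ((j : ZMod (p ^ 2)) + 1 + 1) * (1 - p * Hk) * h
end Harmonic

section Norm

theorem exists_jacobiSum_eq_of_sq_eq_one_of_pow_three_eq_one {F R : Type*} [Field F] [Fintype F]
    [CommRing R] [IsDomain R] {θ χ : MulChar F R} (hθ : θ ^ 2 = 1) (hχ : χ ^ 3 = 1) (hχ1 : χ ≠ 1) :
    ∃ ζ : R, ζ ^ 2 + ζ + 1 = 0 ∧ ∃ A B : ℤ, jacobiSum θ χ = 1 + 2 * A + 2 * B * ζ ∧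
      jacobiSum θ⁻¹ χ⁻¹ = 1 + 2 * A + 2 * B * ζ ^ 2 := by
  classical
  have hθi : θ⁻¹ = θ := by rw [inv_eq_iff_mul_eq_one, ← pow_two, hθ]
  have hχi : χ⁻¹ = χ ^ 2 := by rw [inv_eq_iff_mul_eq_one, ← pow_succ', hχ]
  have hχi1 : χ⁻¹ ≠ 1 := inv_ne_one.2 hχ1
  obtain ⟨a, ha⟩ := MulChar.ne_one_iff.1 hχ1
  have hcube : ∀ u : Fˣ, χ u ^ 3 = 1 := fun u => by
    rw [← MulChar.pow_apply_coe, hχ, MulChar.one_apply_coe]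
  set ζ := χ a with hζ
  have hζ2 : ζ ^ 2 + ζ + 1 = 0 := by
    apply mul_left_cancel₀ (sub_ne_zero.2 ha)
    linear_combination hcube a
  have hrs : ∀ x, ∃ r s : ℤ, χ x = r + s * ζ ∧ χ⁻¹ x = r + s * ζ ^ 2 := by
    intro x
    rcases eq_or_ne x 0 with rfl | hx
    · exact ⟨0, 0, by simp [MulChar.map_zero], by simp [MulChar.map_zero]⟩
    have h3 : χ x ^ 3 = 1 := hcube (Units.mk0 x hx)
    have hprod : (χ x - 1) * ((χ x - ζ) * (χ x - ζ ^ 2)) = 0 := by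
      linear_combination h3 + (-χ x ^ 2 + χ x * ζ - (ζ - 1)) * hζ2
    rw [hχi, MulChar.pow_apply' _ two_ne_zero]
    rcases mul_eq_zero.1 hprod with h | h
    · rw [sub_eq_zero] at h
      exact ⟨1, 0, by simp [h], by simp [h]⟩
    rcases mul_eq_zero.1 h with h | h
    · rw [sub_eq_zero] at h
      exact ⟨0, 1, by simp [h], by simp [h]⟩
    · rw [sub_eq_zero] at h
      refine ⟨-1, -1, ?_, ?_⟩
      · rw [h]; push_cast; linear_combination hζ2
      · rw [h]; push_cast; linear_combination (ζ ^ 2 - ζ + 1) * hζ2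
  choose r s hr hs using hrs
  have hε : ∀ x, ∃ e : ℤ, 1 + θ x = 2 * e + if x = 0 then 1 else 0 := by
    intro x
    rcases eq_or_ne x 0 with rfl | hx
    · exact ⟨0, by simp [MulChar.map_zero]⟩
    have h2 : θ x ^ 2 = 1 := by
      rw [← MulChar.pow_apply' _ two_ne_zero, hθ, MulChar.one_apply (isUnit_iff_ne_zero.2 hx)]
    rcases mul_self_eq_one_iff.1 ((pow_two _).symm.trans h2) with h | h
    · exact ⟨1, by rw [h]; simp [hx]; norm_num⟩
    · exact ⟨0, by rw [h]; simp [hx]⟩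
  choose e he using hε
  have hJ : ∀ ψ : MulChar F R, ψ ≠ 1 → jacobiSum θ ψ = 1 + 2 * ∑ x, e x * ψ (1 - x) := by
    intro ψ hψ
    have h0 : ∑ x, ψ (1 - x) = 0 := by
      rw [← MulChar.sum_eq_zero_of_ne_one hψ]
      exact Equiv.sum_comp (Equiv.subLeft 1) ψ
    have : jacobiSum θ ψ = ∑ x, (2 * (e x * ψ (1 - x)) + if x = 0 then ψ (1 - x) else 0) := by
      rw [show jacobiSum θ ψ = jacobiSum θ ψ + ∑ x, ψ (1 - x) by rw [h0, add_zero], jacobiSum,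
        ← sum_add_distrib]
      refine sum_congr rfl fun x _ => ?_
      have := he x
      split_ifs at this ⊢ <;> linear_combination this * ψ (1 - x)
    rw [this, sum_add_distrib, ← mul_sum, sum_ite_eq' univ (0 : F)]
    simp; ring
  refine ⟨ζ, hζ2, ∑ x, e x * r (1 - x), ∑ x, e x * s (1 - x), ?_, ?_⟩
  · rw [hJ χ hχ1]
    push_cast
    rw [add_assoc, mul_assoc, sum_mul, ← mul_add, ← sum_add_distrib]
    congr 2
    refine sum_congr rfl fun x _ => ?_
    rw [hr]; ring
  · rw [hθi, hJ _ hχi1]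
    push_cast
    rw [add_assoc, mul_assoc, sum_mul, ← mul_add, ← sum_add_distrib]
    congr 2
    refine sum_congr rfl fun x _ => ?_
    rw [hs]; ring

theorem jacobiSum_mul_jacobiSum_inv_padicInt {p : ℕ} [Fact p.Prime] {φ χ : MulChar (ZMod p) ℤ_[p]}
    (hφ : φ ≠ 1) (hχ : χ ≠ 1) (h : φ * χ ≠ 1) :
    jacobiSum φ χ * jacobiSum φ⁻¹ χ⁻¹ = p := by
  have hf : Function.Injective (PadicInt.Coe.ringHom : ℤ_[p] →+* ℚ_[p]) :=
    fun x y hxy => PadicInt.ext hxy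
  have hinv : ∀ ψ : MulChar (ZMod p) ℤ_[p],
      (ψ.ringHomComp PadicInt.Coe.ringHom)⁻¹ = ψ⁻¹.ringHomComp PadicInt.Coe.ringHom := fun ψ => by
    rw [MulChar.ringHomComp_inv]
  apply hf
  rw [map_mul, ← jacobiSum_ringHomComp, ← jacobiSum_ringHomComp, ← hinv, ← hinv,
    jacobiSum_mul_jacobiSum_inv, ZMod.card, map_natCast]
  · rw [ZMod.ringChar_zmod_n, ringChar.eq_zero]
    exact (Fact.out : p.Prime).ne_zero.symm
  · exact (MulChar.ringHomComp_ne_one_iff hf).2 hφ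
  · exact (MulChar.ringHomComp_ne_one_iff hf).2 hχ
  · rw [← MulChar.ringHomComp_mul]
    exact (MulChar.ringHomComp_ne_one_iff hf).2 h

theorem sq_eq_sq_of_prime_eq_sq_add_three_mul_sq {p : ℕ} (hp : p.Prime) {x y X Y : ℤ}
    (h : (p : ℤ) = x ^ 2 + 3 * y ^ 2) (H : (p : ℤ) = X ^ 2 + 3 * Y ^ 2) : x ^ 2 = X ^ 2 := by
  have hp' : Prime (p : ℤ) := Nat.prime_iff_prime_int.1 hp
  have hpos : (0 : ℤ) < p := by exact_mod_cast hp.pos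
  have key : ∀ Y', Y' ^ 2 = Y ^ 2 → (p : ℤ) ∣ x * Y' - X * y → x ^ 2 = X ^ 2 := by
    rintro Y' hY ⟨k, hk⟩
    have h1 : (p : ℤ) ^ 2 = (x * X + 3 * y * Y') ^ 2 + 3 * (p * k) ^ 2 := by
      rw [← hk, pow_two (p : ℤ)]
      nth_rw 1 [h]
      rw [H, ← hY]; ring
    have hk0 : k = 0 := by
      by_contra hk0
      have : 1 ≤ k ^ 2 := by
        have := sq_pos_of_ne_zero hk0
        linarith
      nlinarith [sq_nonneg (x * X + 3 * y * Y')]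
    rw [hk0, mul_zero, sub_eq_zero] at hk
    have h2 : x ^ 2 * Y ^ 2 = X ^ 2 * y ^ 2 := by rw [← hY, ← mul_pow, hk, mul_pow]
    apply mul_left_cancel₀ hpos.ne'
    linear_combination x ^ 2 * H - X ^ 2 * h + 3 * h2
  have hd : (p : ℤ) ∣ (x * Y - X * y) * (x * -Y - X * y) :=
    ⟨y ^ 2 - Y ^ 2, by linear_combination Y ^ 2 * h - y ^ 2 * H⟩
  rcases hp'.dvd_or_dvd hd with h1 | h1
  · exact key Y rfl h1
  · exact key (-Y) (neg_sq Y) h1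

end Norm

section Trace
open Nat
variable {p : ℕ} [Fact p.Prime]

theorem trace_sq_mul_sq_zmod_sq {m : ℕ} (hm : p = 6 * m + 1) (hm0 : 1 ≤ m) {x y : ℤ}
    (hxy : (p : ℤ) = x ^ 2 + 3 * y ^ 2) :
    ∃ u : ZMod (p ^ 2), ((4 * x ^ 2 - 2 * p : ℤ) : ZMod (p ^ 2)) * u ^ 2 = 1 ∧
      ((3 * m)! * (2 * m)! : ZMod (p ^ 2)) * (1 - (p : ZMod (p ^ 2)) *
        (5 * (m : ZMod (p ^ 2)) * harmonicModSq p (5 * m)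
        - 3 * (m : ZMod (p ^ 2)) * harmonicModSq p (3 * m)
        - 2 * (m : ZMod (p ^ 2)) * harmonicModSq p (2 * m))) =
      -(((5 * m)! : ZMod (p ^ 2)) * u) := by
  have hp : p.Prime := Fact.out
  obtain ⟨ω, hω⟩ := exists_teichmullerChar p
  have hne : ∀ k, 1 ≤ k → k < p - 1 → ω ^ k ≠ 1 := fun k h1 h2 h =>
    Nat.not_dvd_of_pos_of_lt h1 h2 ((teichmullerChar_pow_eq_one_iff hω k).1 h)
  have hp1 : ω ^ (6 * m) = 1 := (teichmullerChar_pow_eq_one_iff hω _).2 (by rw [hm]; simp)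
  obtain ⟨u, hu, h⟩ := exists_jacobiSum_teichmullerChar_pow_eq_mul hω
    (show 1 ≤ 3 * m by omega) (2 * m - 1) (by omega)
  have e1 : 2 * m - 1 + 1 = 2 * m := by omega
  have e2 : 3 * m + (2 * m - 1) + 1 = 5 * m := by omega
  have e3 : ((2 * m - 1 : ℕ) : ZMod (p ^ 2)) + 1 = 2 * m := by
    rw [← Nat.cast_add_one, e1]; push_cast; ring
  have e4 : ((3 * m : ℕ) : ZMod (p ^ 2)) + (2 * m - 1 : ℕ) + 1 = 5 * m := by
    rw [add_assoc, e3]; push_cast; ring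
  rw [e1] at hu
  rw [e1, e2, e3, e4] at h
  have hnorm := jacobiSum_mul_jacobiSum_inv_padicInt (hne (3 * m) (by omega) (by omega))
    (hne (2 * m) (by omega) (by omega))
    (by rw [← pow_add]; exact hne _ (by omega) (by omega))
  obtain ⟨ζ, hζ, A, B, hJ, hJ'⟩ := exists_jacobiSum_eq_of_sq_eq_one_of_pow_three_eq_one
    (θ := ω ^ (3 * m)) (χ := ω ^ (2 * m))
    (by rw [← pow_mul, show 3 * m * 2 = 6 * m by ring, hp1])
    (by rw [← pow_mul, show 2 * m * 3 = 6 * m by ring, hp1]) (hne (2 * m) (by omega) (by omega))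
  set J := jacobiSum (ω ^ (3 * m)) (ω ^ (2 * m))
  set J' := jacobiSum (ω ^ (3 * m))⁻¹ (ω ^ (2 * m))⁻¹
  have hXY : (p : ℤ) = (1 + 2 * A - B) ^ 2 + 3 * B ^ 2 := by
    have : ((p : ℤ) : ℤ_[p]) = (((1 + 2 * A - B) ^ 2 + 3 * B ^ 2 : ℤ) : ℤ_[p]) := by
      push_cast
      rw [← hnorm, hJ, hJ']
      linear_combination (2 * B + 4 * A * B - 4 * B ^ 2 + 4 * B ^ 2 * ζ) * hζ
    exact_mod_cast this
  have hx := sq_eq_sq_of_prime_eq_sq_add_three_mul_sq hp hxy hXY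
  have hp0 : (p : ℤ_[p]) ≠ 0 := PadicInt.prime_p.ne_zero
  have huJ' : u * J' = 1 := by
    apply mul_left_cancel₀ hp0
    rw [← mul_assoc, ← hu, hnorm, mul_one]
  have htr : ((4 * x ^ 2 - 2 * p : ℤ) : ℤ_[p]) = (p * u) ^ 2 + J' ^ 2 := by
    rw [hx]
    have h1 : J + J' = 2 * (1 + 2 * A - B) := by
      rw [hJ, hJ']; linear_combination 2 * B * hζ
    push_cast
    rw [← hu]
    linear_combination -(J + J' + 2 * (1 + 2 * A - B)) * h1 + 2 * hnorm
  refine ⟨PadicInt.toZModPow 2 u, ?_, by push_cast at h ⊢; exact h⟩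
  have h1 := congrArg (PadicInt.toZModPow 2) htr
  have h2 := congrArg (PadicInt.toZModPow 2) huJ'
  simp only [map_intCast, map_add, map_mul, map_pow, map_natCast, map_one] at h1 h2
  rw [h1]
  linear_combination PadicInt.toZModPow 2 u ^ 4 * natCast_sq_eq_zero_zmod_sq p +
    (PadicInt.toZModPow 2 u * PadicInt.toZModPow 2 J' + 1) * h2
end Trace

section TraceProd
open Nat
variable {p : ℕ} [Fact p.Prime]

theorem mul_prod_eq_prod_zmod_sq {c T : ZMod (p ^ 2)} (hc : IsUnit c) {a b : ℕ}
    (h : a + (a + b) < p)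
    (hT : T * ((-1) ^ a * (a ! : ZMod (p ^ 2)) ^ 2 * (b ! : ZMod (p ^ 2)) *
      (c - 2 * ((p : ZMod (p ^ 2)) * harmonicModSq p a)
      + (p : ZMod (p ^ 2)) * harmonicModSq p b)) =
      ((a + (a + b))! : ZMod (p ^ 2)) * (c - (p : ZMod (p ^ 2)) * harmonicModSq p (a + (a + b)))) :
    ((∏ d ∈ range a, (-c * ((d : ZMod (p ^ 2)) + 1) + 1 * (p : ZMod (p ^ 2)))) *
      (∏ d ∈ range b, (c * ((d : ZMod (p ^ 2)) + 1) + 1 * (p : ZMod (p ^ 2)))) *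
      (∏ d ∈ range a, (c * ((d : ZMod (p ^ 2)) + 1) + -1 * (p : ZMod (p ^ 2))))) * T =
      ∏ d ∈ range (a + (a + b)), (c * ((d : ZMod (p ^ 2)) + 1) + -1 * (p : ZMod (p ^ 2))) := by
  have h1 := mul_prod_range_zmod_sq (p := p) (-c) 1 (n := a) (by omega)
  have h2 := mul_prod_range_zmod_sq (p := p) c 1 (n := b) (by omega)
  have h3 := mul_prod_range_zmod_sq (p := p) c (-1) (n := a) (by omega)
  have h4 := mul_prod_range_zmod_sq (p := p) c (-1) h
  have hp2 := natCast_sq_eq_zero_zmod_sq p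
  apply (hc.pow 3).mul_left_cancel
  set P1 := ∏ d ∈ range a, (-c * ((d : ZMod (p ^ 2)) + 1) + 1 * (p : ZMod (p ^ 2)))
  set P2 := ∏ d ∈ range b, (c * ((d : ZMod (p ^ 2)) + 1) + 1 * (p : ZMod (p ^ 2)))
  set P3 := ∏ d ∈ range a, (c * ((d : ZMod (p ^ 2)) + 1) + -1 * (p : ZMod (p ^ 2)))
  set P4 := ∏ d ∈ range (a + (a + b)), (c * ((d : ZMod (p ^ 2)) + 1) + -1 * (p : ZMod (p ^ 2)))
  have e : c ^ 3 * (P1 * P2 * P3 * T) = -((-c * P1) * (c * P2) * (c * P3)) * T := by ring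
  have e4 : c ^ 3 * P4 = c ^ 2 * (c * P4) := by ring
  rw [e, e4, h1, h2, h3, h4, neg_pow c a, pow_add, pow_add]
  linear_combination c ^ (2 * a + b + 2) * hT + c ^ (2 * a + b) * T * (-1) ^ a * (a ! : ZMod (p ^ 2)) ^ 2
    * (b ! : ZMod (p ^ 2)) * (c * harmonicModSq p a ^ 2
      - 2 * c * harmonicModSq p a * harmonicModSq p b
      + p * harmonicModSq p a ^ 2 * harmonicModSq p b) * hp2

end TraceProd

section Sum
open Nat

theorem add_one_sub_mul_choose_mul_choose (n k : ℕ) :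
    ((n : ℚ) + 1 - k) * ((n + 1).choose k * (n + 1 + k).choose k) =
      (n + 1 + k) * (n.choose k * (n + k).choose k) := by
  have hn : (n : ℚ) + 1 ≠ 0 := by positivity
  have h1 : (n.choose k : ℚ) * (n + 1) = (n + 1).choose k * (n + 1 - k) := by
    rcases le_or_gt k (n + 1) with h | h
    · have := congrArg (Nat.cast : ℕ → ℚ) (Nat.choose_mul_succ_eq n k)
      push_cast [Nat.cast_sub h] at this
      exact this
    · rw [Nat.choose_eq_zero_of_lt h, Nat.choose_eq_zero_of_lt (by omega : n < k)]; simp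
  have h2 : ((n + k).choose k : ℚ) * (n + 1 + k) = (n + 1 + k).choose k * (n + 1) := by
    have := congrArg (Nat.cast : ℕ → ℚ) (Nat.choose_mul_succ_eq (n + k) k)
    rw [show n + k + 1 - k = n + 1 by omega, show n + k + 1 = n + 1 + k by omega] at this
    exact_mod_cast this
  apply mul_left_cancel₀ hn
  linear_combination -((n + 1).choose k : ℚ) * (n + 1 - k) * h2
    - ((n + k).choose k : ℚ) * (n + 1 + k) * h1

theorem sq_mul_choose_mul_choose_succ (n k : ℕ) :
    ((k : ℚ) + 1) ^ 2 * (n.choose (k + 1) * (n + (k + 1)).choose (k + 1)) =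
      (n - k) * (n + k + 1) * (n.choose k * (n + k).choose k) := by
  have h1 : (n.choose (k + 1) : ℚ) * (k + 1) = n.choose k * (n - k) := by
    rcases le_or_gt k n with h | h
    · have := congrArg (Nat.cast : ℕ → ℚ) (Nat.choose_succ_right_eq n k)
      push_cast [Nat.cast_sub h] at this
      exact this
    · rw [Nat.choose_eq_zero_of_lt h, Nat.choose_eq_zero_of_lt (by omega : n < k + 1)]; simp
  have h2 : ((n : ℚ) + k + 1) * (n + k).choose k = (n + (k + 1)).choose (k + 1) * (k + 1) := by
    exact_mod_cast Nat.add_one_mul_choose_eq (n + k) k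
  linear_combination ((k : ℚ) + 1) * (n + (k + 1)).choose (k + 1) * h1
    - (n.choose k : ℚ) * (n - k) * h2

theorem sum_range_neg_one_pow_mul_choose_div (n K : ℕ) :
    ∑ k ∈ range K, (-1 : ℚ) ^ k * ((n + 1).choose k * (n + 1 + k).choose k) / (n + 1 + k) =
      -(-1) ^ K * ((n + 1).choose K * (n + 1 + K).choose K) * K ^ 2 /
        ((n + 1) ^ 2 * (n + 1 + K)) := by
  induction K with
  | zero => simp
  | succ K ih =>
    rw [sum_range_succ, ih]
    have h := sq_mul_choose_mul_choose_succ (n + 1) K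
    have h1 : (n : ℚ) + 1 + K ≠ 0 := by positivity
    have h2 : (n : ℚ) + 1 + (K + 1) ≠ 0 := by positivity
    have h3 : (n : ℚ) + 1 ≠ 0 := by positivity
    push_cast at h ⊢
    rw [pow_succ]
    generalize ((n + 1).choose K : ℚ) * (n + 1 + K).choose K = E at *
    generalize ((n + 1).choose (K + 1) : ℚ) * (n + 1 + (K + 1)).choose (K + 1) = E' at *
    field_simp
    linear_combination -(-1) ^ K * ((n : ℚ) + 1 + K) * h

theorem prod_mul_sum_neg_one_pow_mul_choose_div (c n : ℕ) :
    (∏ d ∈ range (n + 1), ((c : ℚ) * d + 1)) *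
      ∑ k ∈ range (n + 1), (-1) ^ k * (n.choose k * (n + k).choose k) / ((c : ℚ) * k + 1) =
      ∏ d ∈ range n, ((c : ℚ) * (d + 1) - 1) := by
  induction n with
  | zero => simp
  | succ n ih =>
    rw [prod_range_succ (fun d : ℕ => (c : ℚ) * d + 1) (n + 1),
      prod_range_succ (fun d : ℕ => (c : ℚ) * (d + 1) - 1) n, ← ih]
    have key : ((c : ℚ) * (n + 1) + 1) * (∑ k ∈ range (n + 1 + 1),
          (-1) ^ k * ((n + 1).choose k * (n + 1 + k).choose k) / ((c : ℚ) * k + 1)) -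
        ((c : ℚ) * (n + 1) - 1) * (∑ k ∈ range (n + 1 + 1),
          (-1) ^ k * (n.choose k * (n + k).choose k) / ((c : ℚ) * k + 1)) = 0 := by
      have : ∀ k ∈ range (n + 1 + 1), ((c : ℚ) * (n + 1) + 1) *
            ((-1) ^ k * ((n + 1).choose k * (n + 1 + k).choose k) / ((c : ℚ) * k + 1)) -
          ((c : ℚ) * (n + 1) - 1) * ((-1) ^ k * (n.choose k * (n + k).choose k) / ((c : ℚ) * k + 1))
          = 2 * (n + 1) * ((-1) ^ k * ((n + 1).choose k * (n + 1 + k).choose k) / (n + 1 + k)) := by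
        intro k _
        have h := add_one_sub_mul_choose_mul_choose n k
        have h1 : (n : ℚ) + 1 + k ≠ 0 := by positivity
        have h2 : (c : ℚ) * k + 1 ≠ 0 := by positivity
        generalize ((n + 1).choose k : ℚ) * (n + 1 + k).choose k = E at *
        generalize (n.choose k : ℚ) * (n + k).choose k = E' at *
        field_simp
        linear_combination ((c : ℚ) * (n + 1) - 1) * h
      rw [mul_sum, mul_sum, ← sum_sub_distrib, sum_congr rfl this, ← mul_sum,
        sum_range_neg_one_pow_mul_choose_div, Nat.choose_eq_zero_of_lt (Nat.lt_succ_self (n + 1))]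
      simp
    rw [sum_range_succ (fun k : ℕ => (-1) ^ k * ((n.choose k : ℚ) * (n + k).choose k) /
      ((c : ℚ) * k + 1)) (n + 1), Nat.choose_eq_zero_of_lt (Nat.lt_succ_self n)] at key
    push_cast at key ⊢
    linear_combination (∏ d ∈ range (n + 1), ((c : ℚ) * d + 1)) * key

end Sum

section TraceCongr
open Nat
variable {p : ℕ} [Fact p.Prime]

theorem trace_mul_factorial_zmod_sq {m : ℕ} (hm : p = 6 * m + 1) (hm0 : 1 ≤ m) {x y : ℤ}
    (hxy : (p : ℤ) = x ^ 2 + 3 * y ^ 2) :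
    ((4 * x ^ 2 - 2 * p : ℤ) : ZMod (p ^ 2)) * (m ! : ZMod (p ^ 2)) *
      ((2 * m)! : ZMod (p ^ 2)) ^ 2 * (3 + 2 * ((p : ZMod (p ^ 2)) * harmonicModSq p m) -
        2 * ((p : ZMod (p ^ 2)) * harmonicModSq p (2 * m))) = 3 * ((5 * m)! : ZMod (p ^ 2)) := by
  obtain ⟨u, hu, h⟩ := trace_sq_mul_sq_zmod_sq hm hm0 hxy
  have hodd : Odd p := ⟨3 * m, by omega⟩
  have hp2 := natCast_sq_eq_zero_zmod_sq p
  have hmp : (p : ZMod (p ^ 2)) * (6 * m) = -p := by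
    have : (p : ZMod (p ^ 2)) = 6 * m + 1 := by
      exact_mod_cast congrArg (Nat.cast : ℕ → ZMod (p ^ 2)) hm
    linear_combination hp2 - (p : ZMod (p ^ 2)) * this
  have h5 := mul_harmonicModSq_reflect hodd (n := m) (k := 5 * m) (by omega)
  have f1 := factorial_mul_factorial_zmod_sq (p := p) (n := m) (k := 5 * m) (by omega)
  have f3 := factorial_mul_factorial_zmod_sq (p := p) (n := 3 * m) (k := 3 * m) (by omega)
  have hs : (-1 : ZMod (p ^ 2)) ^ (3 * m) = (-1) ^ m := by rw [pow_mul]; norm_num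
  rw [hs, ← f1] at f3
  set a := (p : ZMod (p ^ 2)) * harmonicModSq p m with ha
  set b := (p : ZMod (p ^ 2)) * harmonicModSq p (2 * m) with hb
  set d := (p : ZMod (p ^ 2)) * harmonicModSq p (3 * m) with hd
  have haa : a * a = 0 := by rw [ha]; linear_combination harmonicModSq p m ^ 2 * hp2
  have hab : a * b = 0 := by
    rw [ha, hb]; linear_combination harmonicModSq p m * harmonicModSq p (2 * m) * hp2
  have had : a * d = 0 := by
    rw [ha, hd]; linear_combination harmonicModSq p m * harmonicModSq p (3 * m) * hp2
  have hbb : b * b = 0 := by rw [hb]; linear_combination harmonicModSq p (2 * m) ^ 2 * hp2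
  have hbd : b * d = 0 := by
    rw [hb, hd]; linear_combination harmonicModSq p (2 * m) * harmonicModSq p (3 * m) * hp2
  have hdd : d * d = 0 := by rw [hd]; linear_combination harmonicModSq p (3 * m) ^ 2 * hp2
  set T := ((4 * x ^ 2 - 2 * p : ℤ) : ZMod (p ^ 2))
  set F1 := (m ! : ZMod (p ^ 2))
  set F2 := ((2 * m)! : ZMod (p ^ 2))
  set F3 := ((3 * m)! : ZMod (p ^ 2))
  have hF5 : IsUnit ((5 * m)! : ZMod (p ^ 2)) := isUnit_factorial_zmod_sq (by omega)
  set F5 := ((5 * m)! : ZMod (p ^ 2))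
  have h6 : F3 * F2 * (6 + 5 * a - 3 * d - 2 * b) = -6 * (F5 * u) := by
    have e1 : (p : ZMod (p ^ 2)) * (6 * m) * harmonicModSq p (5 * m) = -a := by
      rw [hmp]; linear_combination -h5
    have e2 : (p : ZMod (p ^ 2)) * (6 * m) * harmonicModSq p (2 * m) = -b := by
      rw [hmp, hb]; ring
    have e3 : (p : ZMod (p ^ 2)) * (6 * m) * harmonicModSq p (3 * m) = -d := by
      rw [hmp, hd]; ring
    linear_combination 6 * h + F3 * F2 * (5 * e1 - 3 * e3 - 2 * e2)
  have h12 : IsUnit (12 : ZMod (p ^ 2)) := by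
    have h2 := isUnit_natCast_zmod_sq (p := p) (n := 2) (by norm_num) (by omega)
    have h3 := isUnit_natCast_zmod_sq (p := p) (n := 6) (by norm_num) (by omega)
    have := h2.mul h3
    norm_num at this
    exact this
  have hsq : T * F3 ^ 2 * F2 ^ 2 * (3 + 5 * a - 3 * d - 2 * b) = 3 * F5 ^ 2 := by
    apply h12.mul_left_cancel
    linear_combination T * (F3 * F2 * (6 + 5 * a - 3 * d - 2 * b) - 6 * (F5 * u)) * h6 +
      36 * F5 ^ 2 * hu - T * F3 ^ 2 * F2 ^ 2 * (25 * haa + 9 * hdd + 4 * hbb - 30 * had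
        - 20 * hab + 12 * hbd)
  have hF3 : F3 ^ 2 = F5 * F1 * (1 - a + d) := by
    linear_combination (1 + d) * f3 + F3 ^ 2 * hdd - F5 * F1 * had
  rw [hF3] at hsq
  apply hF5.mul_left_cancel
  linear_combination hsq + T * F5 * F1 * F2 ^ 2 * (5 * haa - 8 * had - 2 * hab + 3 * hdd + 2 * hbd)

theorem mul_prod_three_zmod_sq {m : ℕ} (hm : p = 6 * m + 1) (hm0 : 1 ≤ m) {x y : ℤ}
    (hxy : (p : ℤ) = x ^ 2 + 3 * y ^ 2) :
    ((∏ d ∈ range (2 * m), (-3 * ((d : ZMod (p ^ 2)) + 1) + 1 * (p : ZMod (p ^ 2)))) *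
      (∏ d ∈ range m, (3 * ((d : ZMod (p ^ 2)) + 1) + 1 * (p : ZMod (p ^ 2)))) *
      (∏ d ∈ range (2 * m), (3 * ((d : ZMod (p ^ 2)) + 1) + -1 * (p : ZMod (p ^ 2))))) *
      ((4 * x ^ 2 - 2 * p : ℤ) : ZMod (p ^ 2)) =
      ∏ d ∈ range (2 * m + (2 * m + m)), (3 * ((d : ZMod (p ^ 2)) + 1) + -1 * (p : ZMod (p ^ 2))) := by
  have h3 := isUnit_natCast_zmod_sq (p := p) (n := 3) (by norm_num) (by omega)
  push_cast at h3
  have hp2 := natCast_sq_eq_zero_zmod_sq p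
  have h := trace_mul_factorial_zmod_sq hm hm0 hxy
  have h5 := mul_harmonicModSq_reflect (p := p) ⟨3 * m, by omega⟩ (n := m) (k := 5 * m) (by omega)
  refine mul_prod_eq_prod_zmod_sq h3 (by omega) ?_
  rw [show 2 * m + (2 * m + m) = 5 * m by ring, h5, pow_mul, neg_one_sq, one_pow]
  apply h3.mul_left_cancel
  linear_combination (3 - (p : ZMod (p ^ 2)) * harmonicModSq p m) * h +
    ((4 * x ^ 2 - 2 * p : ℤ) : ZMod (p ^ 2)) * (m ! : ZMod (p ^ 2)) *
      ((2 * m)! : ZMod (p ^ 2)) ^ 2 * (2 * harmonicModSq p m ^ 2 -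
        2 * harmonicModSq p m * harmonicModSq p (2 * m)) * hp2

theorem mul_prod_six_zmod_sq {m : ℕ} (hm : p = 6 * m + 1) (hm0 : 1 ≤ m) {x y : ℤ}
    (hxy : (p : ℤ) = x ^ 2 + 3 * y ^ 2) :
    ((∏ d ∈ range m, (-6 * ((d : ZMod (p ^ 2)) + 1) + 1 * (p : ZMod (p ^ 2)))) *
      (∏ d ∈ range (2 * m), (6 * ((d : ZMod (p ^ 2)) + 1) + 1 * (p : ZMod (p ^ 2)))) *
      (∏ d ∈ range m, (6 * ((d : ZMod (p ^ 2)) + 1) + -1 * (p : ZMod (p ^ 2))))) *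
      ((4 * x ^ 2 - 2 * p : ℤ) : ZMod (p ^ 2)) =
      ∏ d ∈ range (m + (m + 2 * m)), (6 * ((d : ZMod (p ^ 2)) + 1) + -1 * (p : ZMod (p ^ 2))) := by
  have h6 := isUnit_natCast_zmod_sq (p := p) (n := 6) (by norm_num) (by omega)
  push_cast at h6
  have hp2 := natCast_sq_eq_zero_zmod_sq p
  have h := trace_mul_factorial_zmod_sq hm hm0 hxy
  have h4 := mul_harmonicModSq_reflect (p := p) ⟨3 * m, by omega⟩ (n := 2 * m) (k := 4 * m)
    (by omega)
  have f1 := factorial_mul_factorial_zmod_sq (p := p) (n := m) (k := 5 * m) (by omega)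
  have f2 := factorial_mul_factorial_zmod_sq (p := p) (n := 2 * m) (k := 4 * m) (by omega)
  have hs : ((-1 : ZMod (p ^ 2)) ^ m) ^ 2 = 1 := by rw [← pow_mul, mul_comm, pow_mul]; simp
  have hF2 : IsUnit ((2 * m)! : ZMod (p ^ 2)) := isUnit_factorial_zmod_sq (by omega)
  refine mul_prod_eq_prod_zmod_sq h6 (by omega) ?_
  rw [show m + (m + 2 * m) = 4 * m by ring, h4]
  rw [pow_mul, neg_one_sq, one_pow, one_mul] at f2
  rw [← f2] at f1
  apply (h6.mul hF2).mul_left_cancel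
  set a := (p : ZMod (p ^ 2)) * harmonicModSq p m with ha
  set b := (p : ZMod (p ^ 2)) * harmonicModSq p (2 * m) with hb
  have haa : a * a = 0 := by rw [ha]; linear_combination harmonicModSq p m ^ 2 * hp2
  have hab : a * b = 0 := by
    rw [ha, hb]; linear_combination harmonicModSq p m * harmonicModSq p (2 * m) * hp2
  have hbb : b * b = 0 := by rw [hb]; linear_combination harmonicModSq p (2 * m) ^ 2 * hp2
  set T := ((4 * x ^ 2 - 2 * p : ℤ) : ZMod (p ^ 2))
  set F1 := (m ! : ZMod (p ^ 2))
  set F2 := ((2 * m)! : ZMod (p ^ 2))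
  set F4 := ((4 * m)! : ZMod (p ^ 2))
  set F5 := ((5 * m)! : ZMod (p ^ 2))
  set s := (-1 : ZMod (p ^ 2)) ^ m
  have f : F1 * F5 = s * (F2 * F4) * (1 - b + a) := by
    linear_combination (1 + a) * f1 + F1 * F5 * haa - s * F2 * F4 * hab
  linear_combination 2 * (6 - 6 * a + 5 * b) * s * (F1 * h + 3 * f) +
    6 * F2 * F4 * (1 - b + a) * (6 - 6 * a + 5 * b) * hs +
    6 * F2 * F4 * (11 * hab - 5 * hbb - 6 * haa) -
    T * s * F1 ^ 2 * F2 ^ 2 * (44 * hab - 24 * haa - 20 * hbb)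
end TraceCongr

section PInt

theorem prod_mul_sum_eq_prod {p c A B : ℕ} (hA : p = c * A + 1) :
    (p : ℚ) * (∑ k ∈ range (A + B + 1),
      (-1) ^ k * ((A + B).choose k * (A + B + k).choose k) / ((c : ℚ) * k + 1)) *
      ((∏ d ∈ range A, (-c * ((d : ℚ) + 1) + 1 * p)) *
        (∏ d ∈ range B, (c * ((d : ℚ) + 1) + 1 * p)) *
        ∏ d ∈ range A, (c * ((d : ℚ) + 1) + -1 * p)) =
      ∏ d ∈ range (A + (A + B)), (c * ((d : ℚ) + 1) + -1 * p) := by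
  have h := prod_mul_sum_neg_one_pow_mul_choose_div c (A + B)
  have hp : (p : ℚ) = c * A + 1 := by exact_mod_cast hA
  rw [show A + B + 1 = A + 1 + B by ring, prod_range_add, prod_range_succ, ← prod_range_reflect,
    show A + 1 + B = A + B + 1 by ring, ← hp] at h
  have h1 : ∏ j ∈ range A, ((c : ℚ) * ((A - 1 - j : ℕ) : ℚ) + 1) =
      ∏ d ∈ range A, (-c * ((d : ℚ) + 1) + 1 * p) := by
    refine prod_congr rfl fun d hd => ?_
    rw [mem_range] at hd
    rw [Nat.sub_sub, Nat.cast_sub (by omega), hp]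
    push_cast; ring
  have h2 : ∏ d ∈ range B, ((c : ℚ) * ((A + 1 + d : ℕ) : ℚ) + 1) =
      ∏ d ∈ range B, (c * ((d : ℚ) + 1) + 1 * p) := by
    refine prod_congr rfl fun d _ => ?_
    rw [hp]; push_cast; ring
  have h3 : ∏ d ∈ range (A + B), (c * (((A + d : ℕ) : ℚ) + 1) + -1 * p) =
      ∏ d ∈ range (A + B), (c * ((d : ℚ) + 1) - 1) := by
    refine prod_congr rfl fun d _ => ?_
    rw [hp]; push_cast; ring
  rw [prod_range_add _ A (A + B), h3, ← h, h1, h2]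
  ring

/-- The subring of `p`-integers in `ℚ`. -/
def pIntSubring (p : ℕ) [hp : Fact p.Prime] : Subring ℚ where
  carrier := {q | isPInt p q}
  zero_mem' := by simp [isPInt, hp.out.ne_one]
  one_mem' := by simp [isPInt, hp.out.ne_one]
  add_mem' {a b} ha hb h := by
    rcases hp.out.dvd_mul.1 (h.trans (Rat.add_den_dvd a b)) with h | h
    exacts [ha h, hb h]
  mul_mem' {a b} ha hb h := by
    rcases hp.out.dvd_mul.1 (h.trans (Rat.mul_den_dvd a b)) with h | h
    exacts [ha h, hb h]
  neg_mem' {a} ha := by simpa [isPInt] using ha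

variable {p : ℕ} [Fact p.Prime]

theorem mem_pIntSubring {q : ℚ} : q ∈ pIntSubring p ↔ isPInt p q := Iff.rfl

theorem inv_intCast_mem_pIntSubring {b : ℤ} (hb : ¬ (p : ℤ) ∣ b) : (b : ℚ)⁻¹ ∈ pIntSubring p := by
  rw [mem_pIntSubring]
  intro h
  have h1 := Rat.den_dvd 1 b
  rw [Rat.divInt_eq_div, Int.cast_one, one_div] at h1
  exact hb ((Int.natCast_dvd_natCast.2 h).trans h1)

theorem inv_natCast_mem_pIntSubring {b : ℕ} (hb : ¬ p ∣ b) : (b : ℚ)⁻¹ ∈ pIntSubring p := by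
  simpa using inv_intCast_mem_pIntSubring (p := p) (b := b) (by rwa [Int.natCast_dvd_natCast])

theorem natCast_div_natCast_mem_pIntSubring {N : ℕ} (h0 : N ≠ 0) (h : N < p ^ 2) :
    (p : ℚ) / N ∈ pIntSubring p := by
  by_cases hN : p ∣ N
  · obtain ⟨q, rfl⟩ := hN
    have hp0 : (p : ℚ) ≠ 0 := Nat.cast_ne_zero.2 (Fact.out : p.Prime).ne_zero
    rw [Nat.cast_mul, div_mul_cancel_left₀ hp0]
    refine inv_natCast_mem_pIntSubring (Nat.not_dvd_of_pos_of_lt ?_ ?_)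
    · exact Nat.pos_of_ne_zero (right_ne_zero_of_mul h0)
    · rw [sq] at h; exact lt_of_mul_lt_mul_left h (Nat.zero_le p)
  · exact mul_mem (natCast_mem _ p) (inv_natCast_mem_pIntSubring hN)

theorem choose_sq_div_sub_mem_pIntSubring {n : ℕ} (hn : p = 2 * n + 1) {k : ℕ} (hk : k < p) :
    (((2 * k).choose k : ℚ) ^ 2 / 16 ^ k - (-1) ^ k * (n.choose k * (n + k).choose k)) / (p : ℚ) ^ 2
      ∈ pIntSubring p := by
  induction k with
  | zero => simp
  | succ k ih =>
    have hp0 : (p : ℚ) ≠ 0 := Nat.cast_ne_zero.2 (Fact.out : p.Prime).ne_zero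
    have h1 : ((2 * (k + 1)).choose (k + 1) : ℚ) * (k + 1) = 2 * (2 * k + 1) * (2 * k).choose k := by
      have := Nat.succ_mul_centralBinom_succ k
      rw [mul_comm] at this
      exact_mod_cast this
    have h2 := sq_mul_choose_mul_choose_succ n k
    have hn' : (n : ℚ) = (p - 1) / 2 := by rw [hn]; push_cast; ring
    have hu : (((2 * (k + 1) : ℕ) : ℚ)⁻¹) ∈ pIntSubring p := by
      refine inv_natCast_mem_pIntSubring fun h => ?_
      rcases (Fact.out : p.Prime).dvd_mul.1 h with h | h
      · have := Nat.le_of_dvd (by norm_num) h; omega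
      · have := Nat.le_of_dvd (by omega) h; omega
    have h3 : (((2 * (k + 1)).choose (k + 1) : ℚ) ^ 2 / 16 ^ (k + 1) -
          (-1) ^ (k + 1) * (n.choose (k + 1) * (n + (k + 1)).choose (k + 1))) / (p : ℚ) ^ 2 =
        (((2 * k + 1 : ℕ) : ℚ) ^ 2 * ((((2 * k).choose k : ℚ) ^ 2 / 16 ^ k -
          (-1) ^ k * (n.choose k * (n + k).choose k)) / (p : ℚ) ^ 2) +
          (-1) ^ k * (n.choose k * (n + k).choose k)) * ((2 * (k + 1) : ℕ) : ℚ)⁻¹ ^ 2 := by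
      have hk0 : (k : ℚ) + 1 ≠ 0 := by positivity
      rw [eq_div_of_mul_eq hk0 h1, eq_div_of_mul_eq (pow_ne_zero 2 hk0)
        ((mul_comm _ _).trans h2), hn']
      push_cast
      field_simp
      ring
    rw [h3]
    refine mul_mem (add_mem (mul_mem (pow_mem (natCast_mem _ _) 2) (ih (by omega))) ?_)
      (pow_mem hu 2)
    exact mul_mem (pow_mem (neg_mem (one_mem _)) _) (mul_mem (natCast_mem _ _) (natCast_mem _ _))

theorem sum_choose_sq_div_sub_mem_pIntSubring {n : ℕ} (hn : p = 2 * n + 1) {c : ℕ} (hc : c < p) :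
    (∑ k ∈ range p, ((2 * k).choose k : ℚ) ^ 2 / 16 ^ k * ((p : ℚ) / ((c : ℚ) * k + 1)) -
      p * ∑ k ∈ range (n + 1), (-1) ^ k * (n.choose k * (n + k).choose k) / ((c : ℚ) * k + 1)) /
      (p : ℚ) ^ 2 ∈ pIntSubring p := by
  have hsub : ∑ k ∈ range (n + 1), (-1) ^ k * (n.choose k * (n + k).choose k) / ((c : ℚ) * k + 1) =
      ∑ k ∈ range p, (-1) ^ k * (n.choose k * (n + k).choose k) / ((c : ℚ) * k + 1) := by
    refine sum_subset (range_subset_range.2 (by omega)) fun k _ hk => ?_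
    rw [Nat.choose_eq_zero_of_lt (n := n) (by rw [mem_range] at hk; omega)]
    simp
  rw [hsub, mul_sum, ← sum_sub_distrib, sum_div]
  refine sum_mem fun k hk => ?_
  rw [mem_range] at hk
  have h1 : (p : ℚ) / ((c * k + 1 : ℕ) : ℚ) ∈ pIntSubring p := by
    refine natCast_div_natCast_mem_pIntSubring (Nat.succ_ne_zero _) ?_
    have : c * k ≤ (2 * n) * (2 * n) := Nat.mul_le_mul (by omega) (by omega)
    have hn0 : n ≠ 0 := by rintro rfl; exact (Fact.out : p.Prime).ne_one hn
    rw [hn]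
    have : 0 < n := Nat.pos_of_ne_zero hn0
    nlinarith
  push_cast at h1
  convert mul_mem (choose_sq_div_sub_mem_pIntSubring hn hk) h1 using 1
  ring

theorem not_dvd_prod_range {c e : ℤ} (hc : ¬ (p : ℤ) ∣ c) {k : ℕ} (hk : k < p) :
    ¬ (p : ℤ) ∣ ∏ d ∈ range k, (c * (d + 1) + e * p) := by
  have hp : Prime (p : ℤ) := Nat.prime_iff_prime_int.1 Fact.out
  rw [hp.dvd_finsetProd_iff]
  rintro ⟨d, hd, h⟩
  rw [mem_range] at hd
  rw [Int.dvd_add_left (Dvd.intro_left _ rfl)] at h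
  refine (hp.dvd_mul.1 h).elim hc fun h => ?_
  have := Int.le_of_dvd (by positivity) h
  omega

theorem sum_sub_mem_pIntSubring {c A B : ℕ} (hA : p = c * A + 1) (hn : p = 2 * (A + B) + 1)
    (hcp : c < p) (t : ℤ)
    (ht : ((∏ d ∈ range A, (-c * ((d : ZMod (p ^ 2)) + 1) + 1 * (p : ZMod (p ^ 2)))) *
      (∏ d ∈ range B, (c * ((d : ZMod (p ^ 2)) + 1) + 1 * (p : ZMod (p ^ 2)))) *
      (∏ d ∈ range A, (c * ((d : ZMod (p ^ 2)) + 1) + -1 * (p : ZMod (p ^ 2))))) *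
      (t : ZMod (p ^ 2)) =
      ∏ d ∈ range (A + (A + B)), (c * ((d : ZMod (p ^ 2)) + 1) + -1 * (p : ZMod (p ^ 2)))) :
    (∑ k ∈ range p, ((2 * k).choose k : ℚ) ^ 2 / 16 ^ k * ((p : ℚ) / ((c : ℚ) * k + 1)) - t) /
      (p : ℚ) ^ 2 ∈ pIntSubring p := by
  have hp : p.Prime := Fact.out
  have hp0 : (p : ℚ) ≠ 0 := Nat.cast_ne_zero.2 hp.ne_zero
  have hc0 : c ≠ 0 := by rintro rfl; exact hp.ne_one (by omega)
  have hcZ : ¬ (p : ℤ) ∣ c := by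
    rw [Int.natCast_dvd_natCast]
    exact Nat.not_dvd_of_pos_of_lt (Nat.pos_of_ne_zero hc0) hcp
  set W : ℤ := (∏ d ∈ range A, (-c * ((d : ℤ) + 1) + 1 * p)) *
    (∏ d ∈ range B, (c * ((d : ℤ) + 1) + 1 * p)) *
    ∏ d ∈ range A, (c * ((d : ℤ) + 1) + -1 * p) with hW
  set N : ℤ := ∏ d ∈ range (A + (A + B)), (c * ((d : ℤ) + 1) + -1 * p) with hN
  have hWp : ¬ (p : ℤ) ∣ W := by
    have hpZ : Prime (p : ℤ) := Nat.prime_iff_prime_int.1 hp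
    rw [hW, hpZ.dvd_mul, hpZ.dvd_mul]
    rintro ((h | h) | h)
    · exact not_dvd_prod_range (by rwa [dvd_neg]) (by omega) h
    · exact not_dvd_prod_range hcZ (by omega) h
    · exact not_dvd_prod_range hcZ (by omega) h
  obtain ⟨q, hq⟩ : ((p ^ 2 : ℕ) : ℤ) ∣ N - W * t := by
    rw [← ZMod.intCast_zmod_eq_zero_iff_dvd, Int.cast_sub, sub_eq_zero, hN, hW]
    push_cast
    exact ht.symm
  have hS := prod_mul_sum_eq_prod (p := p) (B := B) hA
  have hS' : ((p : ℚ) * ∑ k ∈ range (A + B + 1),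
      (-1) ^ k * ((A + B).choose k * (A + B + k).choose k) / ((c : ℚ) * k + 1)) * W = N := by
    rw [hW, hN]; push_cast; exact hS
  have hW0 : (W : ℚ) ≠ 0 := Int.cast_ne_zero.2 fun h => hWp (h ▸ dvd_zero _)
  have h1 := sum_choose_sq_div_sub_mem_pIntSubring hn hcp
  have h2 : ((p : ℚ) * (∑ k ∈ range (A + B + 1),
      (-1) ^ k * ((A + B).choose k * (A + B + k).choose k) / ((c : ℚ) * k + 1)) - t) / (p : ℚ) ^ 2 ∈
        pIntSubring p := by
    convert mul_mem (intCast_mem _ q) (inv_intCast_mem_pIntSubring hWp) using 1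
    have hq' : (N : ℚ) - W * t = p ^ 2 * q := by exact_mod_cast hq
    rw [← hS'] at hq'
    rw [div_eq_iff (pow_ne_zero 2 hp0), mul_assoc, inv_mul_eq_div, mul_div_assoc', eq_div_iff hW0]
    linear_combination hq'
  convert add_mem h1 h2 using 1
  ring

end PInt

end JacobiSum

theorem stmt13 (p : ℕ) (hp : p.Prime) (hp3 : p % 3 = 1) (x y : ℤ)
    (hxy : (p : ℤ) = x ^ 2 + 3 * y ^ 2) :
    pCong p 2
      (∑ k ∈ Finset.range p,
        ((2 * k).choose k : ℚ) ^ 2 / 16 ^ k * ((p : ℚ) / (3 * (k : ℚ) + 1)))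
      (∑ k ∈ Finset.range p,
        ((2 * k).choose k : ℚ) ^ 2 / 16 ^ k * ((p : ℚ) / (6 * (k : ℚ) + 1))) ∧
    pCong p 2
      (∑ k ∈ Finset.range p,
        ((2 * k).choose k : ℚ) ^ 2 / 16 ^ k * ((p : ℚ) / (6 * (k : ℚ) + 1)))
      (4 * (x : ℚ) ^ 2 - 2 * (p : ℚ)) := by
  have : Fact p.Prime := ⟨hp⟩
  obtain ⟨m, hm⟩ : ∃ m, p = 6 * m + 1 := by
    have := hp.eq_two_or_odd
    exact ⟨p / 6, by omega⟩
  have hm0 : 1 ≤ m := by have := hp.two_le; omega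
  have h3 := sum_sub_mem_pIntSubring (c := 3) (A := 2 * m) (B := m) (by omega) (by omega)
    (by omega) (4 * x ^ 2 - 2 * p) (mul_prod_three_zmod_sq hm hm0 hxy)
  have h6 := sum_sub_mem_pIntSubring (c := 6) (A := m) (B := 2 * m) (by omega) (by omega)
    (by omega) (4 * x ^ 2 - 2 * p) (mul_prod_six_zmod_sq hm hm0 hxy)
  push_cast at h3 h6
  refine ⟨?_, h6⟩
  rw [pCong, ← mem_pIntSubring]
  convert sub_mem h3 h6 using 1
  ring
end
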